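/- Let $n\ge 0$ be an integer and let $(M,g)$ be a smooth Riemannian manifold of dimension $2n+1$ with Levi-Civita connection $\nabla$, curvature $R(X,Y)Z=\nabla_X\nabla_YZ-\nabla_Y\nabla_XZ-\nabla_{[X,Y]}Z$, Ricci tensor $S(Y,Z)=\operatorname{tr}(X\mapsto R(X,Y)Z)$ and scalar curvature $r=\operatorname{tr}_g S$. Let $\phi$ be a smooth $(1,1)$-tensor field, $\xi$ a smooth vector field and $\eta$ a smooth $1$-form on $M$ such that $(M,g,\phi,\xi,\eta)$ is a Kenmotsu manifold, i.e., for all smooth vector fields $X,Y$, $$\phi^2X=-X+\eta(X)\xi,\quad \eta(\xi)=1,\quad \eta(X)=g(X,\xi),\quad g(\phi X,\phi Y)=g(X,Y)-\eta(X)\eta(Y),$$ $$(\nabla_X\phi)Y=g(\phi X,Y)\xi-\eta(Y)\phi X.$$ Suppose that $M$ admits a conformal $\eta$-Ricci soliton $(g,V,\lambda,\mu)$, i.e., there are a smooth vector field $V$ and real constants $\lambda,\mu,p$ ($p$ is the conformal pressure) with $$\mathcal L_Vg+2S+\Big[2\lambda-\Big(p+\frac{2}{2n+1}\Big)\Big]g+2\mu\,\eta\otimes\eta=0.$$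 Then the scalar curvature $r$ is differentiable and satisfies $$\xi r=-2n\,[\,r+2n(2n+1)\,]$$ on $M$, where $\xi r$ is the derivative of $r$ along $\xi$. -/

import Mathlib

open Bundle VectorField
open scoped Manifold ContDiff

noncomputable section

namespace RiemannianGeometry

variable {E : Type*} [NormedAddCommGroup E] [NormedSpace ℝ E] [FiniteDimensional ℝ E]
  {H : Type*} [TopologicalSpace H] (I : ModelWithCorners ℝ E H)
  {M : Type*} [TopologicalSpace M] [ChartedSpace H M] [IsManifold I ∞ M]
  [RiemannianBundle (fun x : M ↦ TangentSpace I x)]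

instance finiteDimensional_tangentSpace (x : M) : FiniteDimensional ℝ (TangentSpace I x) :=
  inferInstanceAs (FiniteDimensional ℝ E)

/-- The function `g(X, Y)`, for vector fields `X` and `Y`. The Riemannian metric `g` is the family
of inner products on the tangent spaces. -/
def metric (X Y : Π x : M, TangentSpace I x) (x : M) : ℝ := inner ℝ (X x) (Y x)

/-- The derivative `X f` of the function `f` along the vector field `X`. -/
def dirDeriv (X : Π x : M, TangentSpace I x) (f : M → ℝ) (x : M) : ℝ := mvfderiv I f x (X x)

/-- A smooth vector field. -/
def IsSmoothField (X : Π x : M, TangentSpace I x) : Prop :=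
  ContMDiff I I.tangent ∞ (fun x ↦ (⟨x, X x⟩ : TangentBundle I M))

/-- The right-hand side of the Koszul formula for `2 g(∇_X Y, Z)`. -/
def koszul (X Y Z : Π x : M, TangentSpace I x) (x : M) : ℝ :=
  dirDeriv I X (metric I Y Z) x + dirDeriv I Y (metric I Z X) x - dirDeriv I Z (metric I X Y) x
    - metric I X (mlieBracket I Y Z) x + metric I Y (mlieBracket I Z X) x
    + metric I Z (mlieBracket I X Y) x

/-- An orthonormal basis of the tangent space at `x`. -/
abbrev onb (x : M) : OrthonormalBasis (Fin (Module.finrank ℝ (TangentSpace I x))) ℝ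
    (TangentSpace I x) :=
  stdOrthonormalBasis ℝ (TangentSpace I x)

/-- The vector fields, smooth near `x`, that extend the vectors of the orthonormal basis at `x`. -/
abbrev onbField (x : M) (i : Fin (Module.finrank ℝ (TangentSpace I x))) :
    Π y : M, TangentSpace I y :=
  FiberBundle.extend E (onb I x i)

/-- The Levi-Civita connection `∇_X Y`, given by the Koszul formula: `(∇_X Y)(x)` is the vector
whose inner product with each vector `e i` of an orthonormal basis at `x` is half the right-hand
side of the Koszul formula (at `x`, that expression depends on its last argument only through its
value at `x`). -/
def nabla (X Y : Π x : M, TangentSpace I x) (x : M) : TangentSpace I x :=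
  ∑ i, (koszul I X Y (onbField I x i) x / 2) • onb I x i

/-- The curvature `R(X, Y) Z = ∇_X ∇_Y Z - ∇_Y ∇_X Z - ∇_[X, Y] Z`. -/
def curvature (X Y Z : Π x : M, TangentSpace I x) (x : M) : TangentSpace I x :=
  nabla I X (nabla I Y Z) x - nabla I Y (nabla I X Z) x - nabla I (mlieBracket I X Y) Z x

/-- The Ricci tensor `S(Y, Z) = ∑ i, g(R(e i, Y) Z, e i)`, the trace of `X ↦ R(X, Y) Z`. -/
def ricci (Y Z : Π x : M, TangentSpace I x) (x : M) : ℝ :=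
  ∑ i, inner ℝ (curvature I (onbField I x i) Y Z x) (onb I x i)

/-- The scalar curvature `r = ∑ i, S(e i, e i)`. -/
def scalarCurvature (x : M) : ℝ :=
  ∑ i, ricci I (onbField I x i) (onbField I x i) x

/-- The Lie derivative `(L_V g)(X, Y) = V g(X, Y) - g([V, X], Y) - g(X, [V, Y])`. -/
def lieDerivMetric (V X Y : Π x : M, TangentSpace I x) (x : M) : ℝ :=
  dirDeriv I V (metric I X Y) x - metric I (mlieBracket I V X) Y x
    - metric I X (mlieBracket I V Y) x

variable (M) in
/-- An almost contact metric structure `(φ, ξ, η)` on the Riemannian manifold `M`. -/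
structure AlmostContactMetric where
  /-- the `(1,1)`-tensor field -/
  φ : Π x : M, TangentSpace I x →L[ℝ] TangentSpace I x
  /-- the characteristic vector field -/
  ξ : Π x : M, TangentSpace I x
  /-- the `1`-form -/
  η : Π x : M, TangentSpace I x →L[ℝ] ℝ
  φ_smooth : ContMDiff I (I.prod 𝓘(ℝ, E →L[ℝ] E)) ∞
    (fun x ↦ TotalSpace.mk' (E →L[ℝ] E) (E := fun y : M ↦ TangentSpace I y →L[ℝ] TangentSpace I y)
      x (φ x))
  ξ_smooth : IsSmoothField I ξ
  η_smooth : ContMDiff I (I.prod 𝓘(ℝ, E →L[ℝ] ℝ)) ∞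
    (fun x ↦ TotalSpace.mk' (E →L[ℝ] ℝ) (E := fun y : M ↦ TangentSpace I y →L[ℝ] ℝ) x (η x))
  φ_sq : ∀ (x : M) (v : TangentSpace I x), φ x (φ x v) = -v + η x v • ξ x
  η_ξ : ∀ x : M, η x (ξ x) = 1
  η_eq : ∀ (x : M) (v : TangentSpace I x), η x v = inner ℝ v (ξ x)
  inner_φ : ∀ (x : M) (v w : TangentSpace I x),
    inner ℝ (φ x v) (φ x w) = inner ℝ v w - η x v * η x w

namespace AlmostContactMetric

variable {I}

/-- The Kenmotsu condition `(∇_X φ) Y = g(φ X, Y) ξ - η(Y) φ X`, for all smooth vector fields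
`X` and `Y`, where `(∇_X φ) Y = ∇_X (φ Y) - φ (∇_X Y)`. -/
def IsKenmotsu (A : AlmostContactMetric I M) : Prop :=
  ∀ X Y : Π x : M, TangentSpace I x, IsSmoothField I X → IsSmoothField I Y → ∀ x : M,
    nabla I X (fun y ↦ A.φ y (Y y)) x - A.φ x (nabla I X Y x)
      = (inner ℝ (A.φ x (X x)) (Y x) : ℝ) • A.ξ x - A.η x (Y x) • A.φ x (X x)

/-- `(g, V, lam, mu)` is a conformal `η`-Ricci soliton with conformal pressure `p`:
`V` is a smooth vector field and
`L_V g + 2 S + [2 lam - (p + 2 / dim M)] g + 2 mu η ⊗ η = 0`. -/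
def IsConformalEtaRicciSoliton (A : AlmostContactMetric I M) (V : Π x : M, TangentSpace I x)
    (lam mu p : ℝ) : Prop :=
  IsSmoothField I V ∧
    ∀ X Y : Π x : M, TangentSpace I x, IsSmoothField I X → IsSmoothField I Y → ∀ x : M,
      lieDerivMetric I V X Y x + 2 * ricci I X Y x
        + (2 * lam - (p + 2 / (Module.finrank ℝ E : ℝ))) * metric I X Y x
        + 2 * mu * (A.η x (X x) * A.η x (Y x)) = 0

end AlmostContactMetric

end RiemannianGeometry

end

set_option linter.unusedSectionVars false

noncomputable section

namespace RiemannianGeometry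

/-- The calculus of smooth vector fields on a Riemannian manifold, in algebraic form: `F` is the
algebra of smooth functions and `𝔛` the module of smooth vector fields. -/
structure RiemannianCalculus (F 𝔛 : Type*) [CommRing F] [Algebra ℝ F] [AddCommGroup 𝔛]
    [Module ℝ 𝔛] [Module F 𝔛] [IsScalarTower ℝ F 𝔛] where
  /-- the action of vector fields on functions -/
  D : 𝔛 →ₗ[F] Derivation ℝ F F
  /-- the metric -/
  g : 𝔛 →ₗ[F] 𝔛 →ₗ[F] F
  /-- the Levi-Civita connection -/
  nab : 𝔛 →ₗ[F] 𝔛 →ₗ[ℝ] 𝔛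
  /-- the Lie bracket -/
  lie : 𝔛 → 𝔛 → 𝔛
  /-- the trace of endomorphism fields -/
  tr : (𝔛 →ₗ[F] 𝔛) →ₗ[F] F
  /-- the dimension -/
  dim : ℕ
  g_symm : ∀ X Y, g X Y = g Y X
  g_ext : ∀ {X Y}, (∀ Z, g X Z = g Y Z) → X = Y
  exists_sharp : ∀ θ : 𝔛 →ₗ[F] F, ∃ X, ∀ Z, g X Z = θ Z
  nab_smul : ∀ X (f : F) Y, nab X (f • Y) = D X f • Y + f • nab X Y
  D_g : ∀ X Y Z, D X (g Y Z) = g (nab X Y) Z + g Y (nab X Z)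
  nab_sub_nab : ∀ X Y, nab X Y - nab Y X = lie X Y
  D_lie : ∀ X Y f, D (lie X Y) f = D X (D Y f) - D Y (D X f)
  jacobi : ∀ X Y Z, lie X (lie Y Z) = lie (lie X Y) Z + lie Y (lie X Z)
  tr_comp_comm : ∀ A B : 𝔛 →ₗ[F] 𝔛, tr (A ∘ₗ B) = tr (B ∘ₗ A)
  tr_smulRight : ∀ (θ : 𝔛 →ₗ[F] F) X, tr (θ.smulRight X) = θ X
  tr_adjoint : ∀ {A B : 𝔛 →ₗ[F] 𝔛}, (∀ X Y, g (A X) Y = g X (B Y)) → tr A = tr B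
  D_tr : ∀ X {A B : 𝔛 →ₗ[F] 𝔛}, (∀ Z, B Z = nab X (A Z) - A (nab X Z)) → D X (tr A) = tr B
  tr_id : tr LinearMap.id = (dim : F)

namespace RiemannianCalculus

variable {F 𝔛 : Type*} [CommRing F] [Algebra ℝ F] [AddCommGroup 𝔛]
    [Module ℝ 𝔛] [Module F 𝔛] [IsScalarTower ℝ F 𝔛] (C : RiemannianCalculus F 𝔛)

lemma D_mul (X : 𝔛) (f h : F) : C.D X (f * h) = f * C.D X h + h * C.D X f := by
  simp [Derivation.leibniz]

lemma eq_of_two_mul {f h : F} (H : 2 * f = 2 * h) : f = h := by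
  have : ((2 : ℝ)⁻¹) • ((2 : ℝ) • f) = ((2 : ℝ)⁻¹) • ((2 : ℝ) • h) := by
    congr 1
    rw [Algebra.smul_def, Algebra.smul_def, map_ofNat, H]
  simpa [smul_smul] using this

lemma eq_zero_of_eq_neg {f : F} (H : f = -f) : f = 0 :=
  eq_of_two_mul (by linear_combination H)

/-! ### Lie brackets and Lie derivatives -/

lemma lie_swap (X Y : 𝔛) : C.lie X Y = -C.lie Y X := by
  rw [← C.nab_sub_nab, ← C.nab_sub_nab]; abel

lemma lie_add (X Y Z : 𝔛) : C.lie X (Y + Z) = C.lie X Y + C.lie X Z := by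
  simp only [← C.nab_sub_nab, map_add, LinearMap.add_apply]; abel

lemma lie_sub (X Y Z : 𝔛) : C.lie X (Y - Z) = C.lie X Y - C.lie X Z := by
  simp only [← C.nab_sub_nab, map_sub, LinearMap.sub_apply]; abel

lemma lie_neg (X Y : 𝔛) : C.lie X (-Y) = -C.lie X Y := by
  simp only [← C.nab_sub_nab, map_neg, LinearMap.neg_apply]; abel

lemma lie_smul (X : 𝔛) (f : F) (Y : 𝔛) : C.lie X (f • Y) = C.D X f • Y + f • C.lie X Y := by
  simp only [← C.nab_sub_nab, map_smul, LinearMap.smul_apply, C.nab_smul]; module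

/-- The Lie derivative of a bilinear form. -/
def lieDeriv (U : 𝔛) (b : 𝔛 → 𝔛 → F) (X Y : 𝔛) : F :=
  C.D U (b X Y) - b (C.lie U X) Y - b X (C.lie U Y)

lemma lieDeriv_lie (U V : 𝔛) (b : 𝔛 →ₗ[F] 𝔛 →ₗ[F] F) (X Y : 𝔛) :
    C.lieDeriv (C.lie U V) (fun X Y ↦ b X Y) X Y =
      C.lieDeriv U (C.lieDeriv V (fun X Y ↦ b X Y)) X Y
        - C.lieDeriv V (C.lieDeriv U (fun X Y ↦ b X Y)) X Y := by
  have h₁ := congrArg (fun Z ↦ b Z Y) (C.jacobi U V X)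
  have h₂ := congrArg (b X) (C.jacobi U V Y)
  simp only [map_add, LinearMap.add_apply] at h₁ h₂
  simp only [lieDeriv, C.D_lie, map_sub]
  linear_combination h₁ + h₂

lemma lieDeriv_g (U X Y : 𝔛) : C.lieDeriv U (fun X Y ↦ C.g X Y) X Y
    = C.g (C.nab X U) Y + C.g (C.nab Y U) X := by
  simp only [lieDeriv, C.D_g, ← C.nab_sub_nab, map_sub, LinearMap.sub_apply,
    C.g_symm X (C.nab Y U)]
  ring

/-! ### Curvature of a torsion-free connection -/

/-- A torsion-free connection. -/
structure IsTorsionFree (c : 𝔛 →ₗ[F] 𝔛 →ₗ[ℝ] 𝔛) : Prop where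
  smul : ∀ X (f : F) Y, c X (f • Y) = C.D X f • Y + f • c X Y
  sub : ∀ X Y, c X Y - c Y X = C.lie X Y

lemma isTorsionFree_nab : C.IsTorsionFree C.nab := ⟨C.nab_smul, C.nab_sub_nab⟩

/-- The curvature `c_X c_Y Z - c_Y c_X Z - c_[X, Y] Z` of a connection `c`. -/
def curv (c : 𝔛 →ₗ[F] 𝔛 →ₗ[ℝ] 𝔛) (X Y Z : 𝔛) : 𝔛 :=
  c X (c Y Z) - c Y (c X Z) - c (C.lie X Y) Z

variable {C} {c : 𝔛 →ₗ[F] 𝔛 →ₗ[ℝ] 𝔛}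

lemma curv_swap (X Y Z : 𝔛) : C.curv c X Y Z = -C.curv c Y X Z := by
  simp only [curv, C.lie_swap X Y, map_neg, LinearMap.neg_apply]; abel

lemma curv_add_right (X Y Z Z' : 𝔛) :
    C.curv c X Y (Z + Z') = C.curv c X Y Z + C.curv c X Y Z' := by
  simp only [curv, map_add]; abel

lemma curv_add_mid (X Y Y' Z : 𝔛) :
    C.curv c X (Y + Y') Z = C.curv c X Y Z + C.curv c X Y' Z := by
  simp only [curv, C.lie_add, map_add, LinearMap.add_apply]; abel

lemma curv_add_left (X X' Y Z : 𝔛) :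
    C.curv c (X + X') Y Z = C.curv c X Y Z + C.curv c X' Y Z := by
  rw [curv_swap, curv_add_mid, curv_swap Y X, curv_swap Y X']; abel

lemma IsTorsionFree.curv_smul_right (hc : C.IsTorsionFree c) (X Y : 𝔛) (f : F) (Z : 𝔛) :
    C.curv c X Y (f • Z) = f • C.curv c X Y Z := by
  simp only [curv, hc.smul, map_add, C.D_lie]; module

lemma IsTorsionFree.curv_smul_mid (hc : C.IsTorsionFree c) (X : 𝔛) (f : F) (Y Z : 𝔛) :
    C.curv c X (f • Y) Z = f • C.curv c X Y Z := by
  simp only [curv, hc.smul, map_add, map_smul, LinearMap.add_apply, LinearMap.smul_apply,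
    C.lie_smul]
  module

lemma IsTorsionFree.curv_smul_left (hc : C.IsTorsionFree c) (f : F) (X Y Z : 𝔛) :
    C.curv c (f • X) Y Z = f • C.curv c X Y Z := by
  rw [curv_swap, hc.curv_smul_mid, curv_swap Y X, smul_neg, neg_neg]

lemma IsTorsionFree.bianchi (hc : C.IsTorsionFree c) (X Y Z : 𝔛) :
    C.curv c X Y Z + C.curv c Y Z X + C.curv c Z X Y = 0 := by
  have e : ∀ X Y, c Y X = c X Y - C.lie X Y := fun X Y ↦ by rw [← hc.sub]; abel
  have h := C.jacobi X Y Z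
  have h₁ := hc.sub X (C.lie Y Z)
  have h₂ := hc.sub Y (C.lie Z X)
  have h₃ := hc.sub Z (C.lie X Y)
  simp only [curv]
  simp only [e X Y, e Y Z, e Z X, map_sub]
  rw [C.lie_swap (C.lie X Y) Z, C.lie_swap X Z, C.lie_neg] at h
  linear_combination (norm := module) h₁ + h₂ + h₃ + h

/-- The endomorphism `X ↦ c_X c_Y Z - c_Y c_X Z - c_[X, Y] Z`. -/
def IsTorsionFree.curvLeft (hc : C.IsTorsionFree c) (Y Z : 𝔛) : 𝔛 →ₗ[F] 𝔛 where
  toFun X := C.curv c X Y Z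
  map_add' X X' := curv_add_left X X' Y Z
  map_smul' f X := hc.curv_smul_left f X Y Z

/-- The endomorphism `Z ↦ c_X c_Y Z - c_Y c_X Z - c_[X, Y] Z`. -/
def IsTorsionFree.curvEnd (hc : C.IsTorsionFree c) (X Y : 𝔛) : 𝔛 →ₗ[F] 𝔛 where
  toFun Z := C.curv c X Y Z
  map_add' Z Z' := curv_add_right X Y Z Z'
  map_smul' f Z := hc.curv_smul_right X Y f Z

/-- The trace of `X ↦ c_X c_Y Z - c_Y c_X Z - c_[X, Y] Z`. -/
def IsTorsionFree.ric (hc : C.IsTorsionFree c) : 𝔛 →ₗ[F] 𝔛 →ₗ[F] F :=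
  LinearMap.mk₂ F (fun Y Z ↦ C.tr (hc.curvLeft Y Z))
    (fun Y Y' Z ↦ by
      rw [← map_add]; congr 1; ext X; exact curv_add_mid X Y Y' Z)
    (fun f Y Z ↦ by
      rw [← map_smul]; congr 1; ext X; exact hc.curv_smul_mid X f Y Z)
    (fun Y Z Z' ↦ by
      rw [← map_add]; congr 1; ext X; exact curv_add_right X Y Z Z')
    (fun f Y Z ↦ by
      rw [← map_smul]; congr 1; ext X; exact hc.curv_smul_right X Y f Z)

lemma IsTorsionFree.ric_apply (hc : C.IsTorsionFree c) (Y Z : 𝔛) :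
    hc.ric Y Z = C.tr (hc.curvLeft Y Z) := rfl

lemma IsTorsionFree.pair_symm (hc : C.IsTorsionFree c)
    (hs : ∀ X Y Z W, C.g (C.curv c X Y Z) W = -C.g (C.curv c X Y W) Z) (X Y Z W : 𝔛) :
    C.g (C.curv c X Y Z) W = C.g (C.curv c Z W X) Y := by
  have b : ∀ X Y Z W, C.g (C.curv c X Y Z) W + C.g (C.curv c Y Z X) W
      + C.g (C.curv c Z X Y) W = 0 := fun X Y Z W ↦ by
    rw [← LinearMap.add_apply, ← map_add, ← LinearMap.add_apply, ← map_add, hc.bianchi, map_zero,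
      LinearMap.zero_apply]
  have s : ∀ X Y Z W, C.g (C.curv c X Y Z) W = -C.g (C.curv c Y X Z) W := fun X Y Z W ↦ by
    rw [curv_swap, map_neg, LinearMap.neg_apply]
  apply eq_of_two_mul
  linear_combination b Z X Y W - b X Y W Z - b Y W Z X + b W Z X Y + hs X Y W Z + hs Y W X Z
    + hs W Z Y X - hs Z X W Y + s Z Y W X - hs Y Z W X - s X W Z Y + hs W X Z Y - 2 * s W Z X Y

end RiemannianCalculus

namespace RiemannianCalculus

variable {F 𝔛 : Type*} [CommRing F] [Algebra ℝ F] [AddCommGroup 𝔛]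
    [Module ℝ 𝔛] [Module F 𝔛] [IsScalarTower ℝ F 𝔛]

/-- A Kenmotsu structure. -/
structure Kenmotsu (C : RiemannianCalculus F 𝔛) where
  /-- the `(1,1)`-tensor field -/
  φ : 𝔛 →ₗ[F] 𝔛
  /-- the characteristic vector field -/
  ξ : 𝔛
  φ_φ' : ∀ X, φ (φ X) = -X + C.g X ξ • ξ
  g_ξ_ξ : C.g ξ ξ = 1
  φ_ξ : φ ξ = 0
  g_φ_φ' : ∀ X Y, C.g (φ X) (φ Y) = C.g X Y - C.g X ξ * C.g Y ξ
  nab_φ' : ∀ X Y, C.nab X (φ Y) - φ (C.nab X Y) = C.g (φ X) Y • ξ - C.g Y ξ • φ X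

namespace Kenmotsu

variable {C : RiemannianCalculus F 𝔛} (K : C.Kenmotsu)

/-- The `1`-form `η = g(·, ξ)`. -/
def η : 𝔛 →ₗ[F] F := C.g.flip K.ξ

lemma g_ξ (X : 𝔛) : C.g X K.ξ = K.η X := rfl

lemma ξ_g (X : 𝔛) : C.g K.ξ X = K.η X := C.g_symm _ _

@[simp] lemma η_ξ : K.η K.ξ = 1 := K.g_ξ_ξ

lemma φ_φ (X : 𝔛) : K.φ (K.φ X) = -X + K.η X • K.ξ := K.φ_φ' X

lemma g_φ_φ (X Y : 𝔛) : C.g (K.φ X) (K.φ Y) = C.g X Y - K.η X * K.η Y := K.g_φ_φ' X Y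

lemma nab_φ (X Y : 𝔛) :
    C.nab X (K.φ Y) = K.φ (C.nab X Y) + C.g (K.φ X) Y • K.ξ - K.η Y • K.φ X := by
  rw [add_sub_assoc, ← K.g_ξ Y, ← K.nab_φ']; abel

@[simp] lemma η_φ (X : 𝔛) : K.η (K.φ X) = 0 := by
  have h := congrArg K.φ (K.φ_φ X)
  rw [K.φ_φ, map_add, map_neg, map_smul, K.φ_ξ, smul_zero, add_zero, add_eq_left] at h
  simpa using congrArg K.η h

lemma g_φ_left (X Y : 𝔛) : C.g (K.φ X) Y = -C.g X (K.φ Y) := by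
  have h := K.g_φ_φ (K.φ X) Y
  rw [K.φ_φ] at h
  simp only [map_add, map_neg, map_smul, LinearMap.add_apply, LinearMap.neg_apply,
    LinearMap.smul_apply, K.ξ_g, K.η_φ, smul_zero] at h
  linear_combination -h

lemma η_nab_ξ (X : 𝔛) : K.η (C.nab X K.ξ) = 0 := by
  have h := C.D_g X K.ξ K.ξ
  rw [K.g_ξ_ξ, K.g_ξ, K.ξ_g, (C.D X).map_one_eq_zero] at h
  exact eq_of_two_mul (by linear_combination -h)

lemma nab_ξ (X : 𝔛) : C.nab X K.ξ = X - K.η X • K.ξ := by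
  have h := K.nab_φ X K.ξ
  rw [K.φ_ξ, map_zero, K.g_ξ, K.η_φ, K.η_ξ] at h
  have h' := congrArg K.φ h
  simp only [map_zero, map_sub, map_add, map_smul, K.φ_φ, K.η_nab_ξ, K.φ_ξ] at h'
  linear_combination (norm := module) h'

lemma D_η (X Y : 𝔛) :
    C.D X (K.η Y) = K.η (C.nab X Y) + C.g X Y - K.η X * K.η Y := by
  rw [← K.g_ξ, C.D_g, K.nab_ξ, K.g_ξ, map_sub, map_smul, K.g_ξ, smul_eq_mul, C.g_symm Y X]
  ring

/-- The metric transverse to `ξ`. -/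
def gp : 𝔛 →ₗ[F] 𝔛 →ₗ[F] F :=
  LinearMap.mk₂ F (fun X Y ↦ C.g X Y - K.η X * K.η Y)
    (fun _ _ _ ↦ by simp only [map_add, LinearMap.add_apply]; ring)
    (fun _ _ _ ↦ by simp only [map_smul, LinearMap.smul_apply, smul_eq_mul]; ring)
    (fun _ _ _ ↦ by simp only [map_add]; ring)
    (fun _ _ _ ↦ by simp only [map_smul, smul_eq_mul]; ring)

lemma gp_apply (X Y : 𝔛) : K.gp X Y = C.g X Y - K.η X * K.η Y := rfl

lemma gp_symm (X Y : 𝔛) : K.gp X Y = K.gp Y X := by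
  rw [gp_apply, gp_apply, C.g_symm]; ring

/-- The connection for which the local product structure transverse to `ξ` is parallel. -/
def tn : 𝔛 →ₗ[F] 𝔛 →ₗ[ℝ] 𝔛 :=
  LinearMap.mk₂' F ℝ
    (fun X Y ↦ C.nab X Y + (C.g X Y + K.η X * K.η Y) • K.ξ - K.η X • Y - K.η Y • X)
    (fun _ _ _ ↦ by simp only [map_add, LinearMap.add_apply]; module)
    (fun _ _ _ ↦ by simp only [map_smul, LinearMap.smul_apply, smul_eq_mul]; module)
    (fun _ _ _ ↦ by simp only [map_add]; module)
    (fun r X Y ↦ by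
      simp only [← algebraMap_smul F r Y, map_smul, C.nab_smul, Derivation.map_algebraMap,
        smul_eq_mul, ← algebraMap_smul F r (_ : 𝔛)]
      module)

lemma tn_apply (X Y : 𝔛) :
    K.tn X Y = C.nab X Y + (C.g X Y + K.η X * K.η Y) • K.ξ - K.η X • Y - K.η Y • X := rfl

lemma isTorsionFree_tn : C.IsTorsionFree K.tn where
  smul X f Y := by simp only [tn_apply, C.nab_smul, map_smul, smul_eq_mul]; module
  sub X Y := by simp only [tn_apply, ← C.nab_sub_nab, C.g_symm Y X]; module

@[simp] lemma tn_ξ (X : 𝔛) : K.tn X K.ξ = 0 := by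
  rw [tn_apply, K.nab_ξ, K.g_ξ, K.η_ξ]; module

lemma tn_φ (X Y : 𝔛) : K.tn X (K.φ Y) = K.φ (K.tn X Y) := by
  simp only [tn_apply, K.nab_φ, K.g_φ_left X Y, K.η_φ, map_add, map_sub, map_smul, K.φ_ξ]
  module

lemma D_η' (X Y : 𝔛) : C.D X (K.η Y) = K.η (K.tn X Y) := by
  simp only [tn_apply, K.D_η, map_add, map_sub, map_smul, K.η_ξ, smul_eq_mul]; ring

lemma D_gp (X Y Z : 𝔛) :
    C.D X (K.gp Y Z) = K.gp (K.tn X Y) Z + K.gp Y (K.tn X Z) + 2 * K.η X * K.gp Y Z := by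
  simp only [gp_apply, map_sub, C.D_mul, K.D_η', C.D_g]
  simp only [tn_apply, map_add, map_sub, map_smul, LinearMap.add_apply, LinearMap.sub_apply,
    LinearMap.smul_apply, K.ξ_g, K.g_ξ, K.η_ξ, smul_eq_mul, C.g_symm Y X]
  ring

lemma lie_ξ (X : 𝔛) : C.lie K.ξ X = K.tn K.ξ X := by
  rw [← K.isTorsionFree_tn.sub, K.tn_ξ, sub_zero]

lemma η_lie (X Y : 𝔛) : K.η (C.lie X Y) = C.D X (K.η Y) - C.D Y (K.η X) := by
  rw [← K.isTorsionFree_tn.sub, map_sub, K.D_η', K.D_η']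

/-! ### The transverse curvature -/

lemma curv_tn (X Y Z : 𝔛) :
    C.curv K.tn X Y Z = C.curv C.nab X Y Z + C.g Y Z • X - C.g X Z • Y := by
  have hl := C.nab_sub_nab X Y
  simp only [curv, tn_apply, map_add, map_sub, C.nab_smul, map_smul, K.nab_ξ, K.D_η, C.D_g,
    C.D_mul, K.g_ξ, K.η_ξ, smul_eq_mul, ← hl, LinearMap.sub_apply, C.g_symm Y X]
  module

end Kenmotsu

end RiemannianCalculus

namespace RiemannianCalculus

variable {F 𝔛 : Type*} [CommRing F] [Algebra ℝ F] [AddCommGroup 𝔛]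
    [Module ℝ 𝔛] [Module F 𝔛] [IsScalarTower ℝ F 𝔛]

lemma g_curv_nab (C : RiemannianCalculus F 𝔛) (X Y Z W : 𝔛) :
    C.g (C.curv C.nab X Y Z) W = -C.g (C.curv C.nab X Y W) Z := by
  have h := C.D_lie X Y (C.g Z W)
  simp only [C.D_g, map_add] at h
  simp only [curv, map_sub, LinearMap.sub_apply, C.g_symm _ Z]
  linear_combination -h

namespace Kenmotsu

variable {C : RiemannianCalculus F 𝔛} (K : C.Kenmotsu)

lemma g_curv (X Y Z W : 𝔛) : C.g (C.curv K.tn X Y Z) W = -C.g (C.curv K.tn X Y W) Z := by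
  simp only [K.curv_tn, map_add, map_sub, map_smul, LinearMap.add_apply, LinearMap.sub_apply,
    LinearMap.smul_apply, smul_eq_mul]
  linear_combination C.g_curv_nab X Y Z W

lemma pair_symm (X Y Z W : 𝔛) : C.g (C.curv K.tn X Y Z) W = C.g (C.curv K.tn Z W X) Y :=
  K.isTorsionFree_tn.pair_symm K.g_curv X Y Z W

lemma curv_φ (X Y Z : 𝔛) : C.curv K.tn X Y (K.φ Z) = K.φ (C.curv K.tn X Y Z) := by
  simp only [curv, K.tn_φ, map_sub]

lemma curv_ξ_right (X Y : 𝔛) : C.curv K.tn X Y K.ξ = 0 := by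
  simp [curv]

lemma η_curv (X Y Z : 𝔛) : K.η (C.curv K.tn X Y Z) = 0 := by
  rw [← K.g_ξ, K.g_curv, K.curv_ξ_right, map_zero, LinearMap.zero_apply, neg_zero]

lemma curv_ξ_left (X Y : 𝔛) : C.curv K.tn K.ξ X Y = 0 := by
  refine C.g_ext fun W ↦ ?_
  rw [K.pair_symm, K.curv_ξ_right, map_zero]; simp

lemma curv_φ_φ (X Y Z : 𝔛) : C.curv K.tn (K.φ X) (K.φ Y) Z = C.curv K.tn X Y Z := by
  refine C.g_ext fun W ↦ ?_
  rw [K.pair_symm, K.curv_φ, K.g_φ_φ, K.η_curv, zero_mul, sub_zero, ← K.pair_symm]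

/-- The connection `tn` is invariant under the flow of `ξ`. -/
lemma tn_ξ_tn (X Y : 𝔛) :
    K.tn K.ξ (K.tn X Y) = K.tn X (K.tn K.ξ Y) + K.tn (K.tn K.ξ X) Y := by
  have h := K.curv_ξ_left X Y
  rw [curv, K.lie_ξ] at h
  linear_combination (norm := module) h

lemma tn_ξ_lie (X Y : 𝔛) :
    K.tn K.ξ (C.lie X Y) = C.lie (K.tn K.ξ X) Y + C.lie X (K.tn K.ξ Y) := by
  rw [← K.lie_ξ, C.jacobi, K.lie_ξ, K.lie_ξ]

lemma tn_ξ_curv (X Y Z : 𝔛) : K.tn K.ξ (C.curv K.tn X Y Z) =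
    C.curv K.tn (K.tn K.ξ X) Y Z + C.curv K.tn X (K.tn K.ξ Y) Z
      + C.curv K.tn X Y (K.tn K.ξ Z) := by
  simp only [curv, map_sub, K.tn_ξ_tn, K.tn_ξ_lie, map_add, LinearMap.add_apply]
  module

/-- The trace of the transverse curvature. -/
abbrev ric : 𝔛 →ₗ[F] 𝔛 →ₗ[F] F := K.isTorsionFree_tn.ric

lemma ric_symm (Y Z : 𝔛) : K.ric Y Z = K.ric Z Y := by
  refine C.tr_adjoint fun X W ↦ ?_
  change C.g (C.curv K.tn X Y Z) W = C.g X (C.curv K.tn W Z Y)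
  rw [K.pair_symm, C.g_symm X, K.g_curv, curv_swap, map_neg, LinearMap.neg_apply, neg_neg]

lemma ric_ξ (Y : 𝔛) : K.ric Y K.ξ = 0 := by
  rw [IsTorsionFree.ric_apply, ← map_zero C.tr]
  congr 1; ext X; exact K.curv_ξ_right X Y

lemma ξ_ric (Y : 𝔛) : K.ric K.ξ Y = 0 := by rw [K.ric_symm, K.ric_ξ]

lemma ric_φ_φ (Y Z : 𝔛) : K.ric (K.φ Y) (K.φ Z) = K.ric Y Z := by
  have h : K.isTorsionFree_tn.curvLeft (K.φ Y) (K.φ Z)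
      = K.φ ∘ₗ K.isTorsionFree_tn.curvLeft (K.φ Y) Z := by
    ext X; exact K.curv_φ X (K.φ Y) Z
  rw [IsTorsionFree.ric_apply, h, C.tr_comp_comm, IsTorsionFree.ric_apply]
  congr 1; ext X; exact K.curv_φ_φ X Y Z

lemma ric_φ_left (Y Z : 𝔛) : K.ric (K.φ Y) Z = -K.ric Y (K.φ Z) := by
  have h := K.ric_φ_φ (K.φ Y) Z
  rw [K.φ_φ] at h
  simp only [map_add, map_neg, map_smul, LinearMap.add_apply, LinearMap.neg_apply,
    LinearMap.smul_apply, K.ξ_ric, smul_zero] at h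
  linear_combination -h

lemma D_ξ_tr (A B : 𝔛 →ₗ[F] 𝔛) (h : ∀ Z, B Z = K.tn K.ξ (A Z) - A (K.tn K.ξ Z)) :
    C.D K.ξ (C.tr A) = C.tr B := by
  set N : 𝔛 →ₗ[F] 𝔛 := K.η.smulRight K.ξ with hN
  have h' : C.D K.ξ (C.tr A) = C.tr (B - N ∘ₗ A + A ∘ₗ N) := by
    refine C.D_tr K.ξ fun Z ↦ ?_
    simp only [hN, LinearMap.add_apply, LinearMap.sub_apply, h, tn_apply, map_add, map_sub,
      map_smul, LinearMap.comp_apply, LinearMap.smulRight_apply, K.ξ_g, K.η_ξ]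
    module
  rw [h', map_add, map_sub, C.tr_comp_comm N A]; ring

lemma D_ξ_ric (Y Z : 𝔛) :
    C.D K.ξ (K.ric Y Z) = K.ric (K.tn K.ξ Y) Z + K.ric Y (K.tn K.ξ Z) := by
  simp only [IsTorsionFree.ric_apply]
  rw [← map_add]
  refine K.D_ξ_tr _ _ fun X ↦ ?_
  change C.curv K.tn X (K.tn K.ξ Y) Z + C.curv K.tn X Y (K.tn K.ξ Z)
    = K.tn K.ξ (C.curv K.tn X Y Z) - C.curv K.tn (K.tn K.ξ X) Y Z
  rw [K.tn_ξ_curv]; abel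

/-! ### The Ricci operator and the scalar curvature -/

lemma exists_ricOp : ∃ T : 𝔛 →ₗ[F] 𝔛, ∀ X Y, C.g (T X) Y = K.ric X Y := by
  choose T hT using fun X ↦ C.exists_sharp (K.ric X)
  refine ⟨⟨⟨T, fun X Y ↦ C.g_ext fun Z ↦ ?_⟩, fun f X ↦ C.g_ext fun Z ↦ ?_⟩, hT⟩
  · simp [hT]
  · simp [hT]

/-- The endomorphism `T` with `g(T X, Y) = ric X Y`. -/
def ricOp : 𝔛 →ₗ[F] 𝔛 := K.exists_ricOp.choose

lemma g_ricOp (X Y : 𝔛) : C.g (K.ricOp X) Y = K.ric X Y := K.exists_ricOp.choose_spec X Y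

@[simp] lemma η_ricOp (X : 𝔛) : K.η (K.ricOp X) = 0 := by rw [← K.g_ξ, K.g_ricOp, K.ric_ξ]

/-- The derivative of the scalar curvature along `ξ`. -/
theorem D_ξ_tr_ricOp : C.D K.ξ (C.tr K.ricOp) = -2 * C.tr K.ricOp := by
  have h : C.D K.ξ (C.tr K.ricOp) = C.tr ((-2 : F) • K.ricOp) := by
    refine K.D_ξ_tr _ _ fun X ↦ C.g_ext fun Y ↦ ?_
    have h₁ := K.D_gp K.ξ (K.ricOp X) Y
    simp only [gp_apply, K.η_ricOp, K.g_ricOp, zero_mul, sub_zero, ← K.D_η', map_zero, K.η_ξ,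
      K.D_ξ_ric] at h₁
    simp only [LinearMap.smul_apply, map_smul, map_sub, LinearMap.sub_apply, K.g_ricOp, smul_eq_mul]
    linear_combination h₁
  rw [h, map_smul, smul_eq_mul]

end Kenmotsu

end RiemannianCalculus

namespace RiemannianCalculus

variable {F 𝔛 : Type*} [CommRing F] [Algebra ℝ F] [AddCommGroup 𝔛]
    [Module ℝ 𝔛] [Module F 𝔛] [IsScalarTower ℝ F 𝔛]

lemma D_two (C : RiemannianCalculus F 𝔛) (X : 𝔛) : C.D X 2 = 0 := by
  simpa using (C.D X).map_natCast 2

namespace Kenmotsu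

variable {C : RiemannianCalculus F 𝔛} (K : C.Kenmotsu)

/-- The soliton equation `L_V g = -2 ric + 2 (a + m) g - 2 m η ⊗ η`, with constants `a` and `m`. -/
structure IsSoliton (V : 𝔛) (a m : F) : Prop where
  D_a : ∀ X, C.D X a = 0
  D_m : ∀ X, C.D X m = 0
  eq : ∀ X Y, C.lieDeriv V (fun X Y ↦ C.g X Y) X Y
    = -2 * K.ric X Y + 2 * (a + m) * C.g X Y - 2 * m * (K.η X * K.η Y)

lemma lieDeriv_ξ_g (X Y : 𝔛) :
    C.lieDeriv K.ξ (fun X Y ↦ C.g X Y) X Y = 2 * K.gp X Y := by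
  simp only [C.lieDeriv_g, K.nab_ξ, gp_apply, map_sub, map_smul, LinearMap.sub_apply,
    LinearMap.smul_apply, K.ξ_g, smul_eq_mul, C.g_symm Y X]
  ring

variable {K} {V : 𝔛} {a m : F}

namespace IsSoliton

lemma D_ξ_η (hV : K.IsSoliton V a m) : C.D K.ξ (K.η V) = a := by
  have h := hV.eq K.ξ K.ξ
  rw [C.lieDeriv_g, K.g_ξ, K.ric_ξ, K.g_ξ, K.η_ξ] at h
  have h' := K.D_η K.ξ V
  rw [K.ξ_g, K.η_ξ] at h'
  exact eq_of_two_mul (by linear_combination 2 * h' + h)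

variable (K V a) in
/-- The vector field `2 a ξ - [ξ, V]`, which for a soliton is the gradient of `η(V)`. -/
def grad : 𝔛 := (2 * a) • K.ξ - C.lie K.ξ V

lemma g_grad (hV : K.IsSoliton V a m) (X : 𝔛) : C.g (grad K V a) X = C.D X (K.η V) := by
  have h := hV.eq X K.ξ
  rw [C.lieDeriv_g, K.g_ξ, K.g_ξ, K.ric_ξ, K.η_ξ] at h
  have h' := K.D_η X V
  simp only [grad, ← C.nab_sub_nab, K.nab_ξ, map_sub, map_smul, LinearMap.sub_apply,
    LinearMap.smul_apply, K.ξ_g, smul_eq_mul]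
  rw [C.g_symm V X]
  linear_combination -h - h'

/-- The Hessian of `η(V)`. -/
lemma g_nab_grad (hV : K.IsSoliton V a m) (X Y : 𝔛) :
    C.g (C.nab X (grad K V a)) Y = 2 * a * C.g X Y - 2 * K.ric X Y
    - (C.D X (K.η V) * K.η Y + K.η X * C.D Y (K.η V)) := by
  have hsymm : C.g (C.nab Y (grad K V a)) X = C.g (C.nab X (grad K V a)) Y := by
    have h₁ := C.D_g X (grad K V a) Y
    have h₂ := C.D_g Y (grad K V a) X
    have h₃ := C.D_lie X Y (K.η V)
    rw [← C.nab_sub_nab, map_sub, Derivation.sub_apply] at h₃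
    simp only [hV.g_grad] at h₁ h₂
    linear_combination h₁ - h₂ + h₃
  have hlie := C.lieDeriv_lie K.ξ V C.g X Y
  have e₁ : C.lie K.ξ V = (2 * a) • K.ξ - grad K V a := by rw [grad]; abel
  have h₁ : C.lieDeriv (C.lie K.ξ V) (fun X Y ↦ C.g X Y) X Y
      = 4 * a * K.gp X Y - 2 * C.g (C.nab X (grad K V a)) Y := by
    have h := K.lieDeriv_ξ_g X Y
    rw [C.lieDeriv_g] at h
    simp only [C.lieDeriv_g, e₁, map_sub, C.nab_smul, C.D_mul, C.D_two, hV.D_a, LinearMap.sub_apply,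
      map_add, LinearMap.add_apply, map_smul, LinearMap.smul_apply, smul_eq_mul, hsymm]
    linear_combination 2 * a * h
  have h₂ : C.lieDeriv K.ξ (C.lieDeriv V (fun X Y ↦ C.g X Y)) X Y
      = 4 * (a + m) * K.gp X Y := by
    have h := K.lieDeriv_ξ_g X Y
    rw [show C.lieDeriv V (fun X Y ↦ C.g X Y) = _ from funext₂ hV.eq]
    simp only [lieDeriv, K.lie_ξ, map_add, map_sub, map_neg, C.D_mul, C.D_two, hV.D_a, hV.D_m,
      K.D_ξ_ric, K.D_η'] at h ⊢
    linear_combination 2 * (a + m) * h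
  have h₃ : C.lieDeriv V (C.lieDeriv K.ξ (fun X Y ↦ C.g X Y)) X Y
      = -4 * K.ric X Y + 4 * (a + m) * C.g X Y - 4 * m * (K.η X * K.η Y)
        - 2 * (C.D X (K.η V) * K.η Y + K.η X * C.D Y (K.η V)) := by
    have h := hV.eq X Y
    rw [show C.lieDeriv K.ξ (fun X Y ↦ C.g X Y) = _ from funext₂ K.lieDeriv_ξ_g]
    simp only [lieDeriv, gp_apply, map_sub, C.D_mul, C.D_two, K.η_lie] at h ⊢
    linear_combination 2 * h
  rw [h₁, h₂, h₃] at hlie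
  apply eq_of_two_mul
  rw [gp_apply] at hlie
  linear_combination -hlie

lemma tn_hess (hV : K.IsSoliton V a m) (X Y : 𝔛) :
    C.D X (C.D Y (K.η V)) - C.D (K.tn X Y) (K.η V) = a * K.gp X Y - 2 * K.ric X Y := by
  have h := C.D_g X (grad K V a) Y
  rw [hV.g_grad, hV.g_grad, hV.g_nab_grad] at h
  simp only [tn_apply, map_add, map_sub, map_smul, Derivation.add_apply, Derivation.sub_apply,
    Derivation.smul_apply, hV.D_ξ_η, smul_eq_mul, gp_apply]
  linear_combination h

lemma mul_gp (hV : K.IsSoliton V a m) (X Y : 𝔛) : a * K.gp X Y = 0 := by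
  have h₀ := congrArg (C.D K.ξ) (hV.tn_hess X Y)
  have h₁ := hV.tn_hess (K.tn K.ξ X) Y
  have h₂ := hV.tn_hess X (K.tn K.ξ Y)
  have l₁ := C.D_lie K.ξ X (C.D Y (K.η V))
  have l₂ := C.D_lie K.ξ Y (K.η V)
  have l₃ := C.D_lie K.ξ (K.tn X Y) (K.η V)
  rw [hV.D_ξ_η, hV.D_a, K.lie_ξ, sub_zero] at l₂
  rw [hV.D_ξ_η, hV.D_a, K.lie_ξ, K.tn_ξ_tn, sub_zero, map_add, Derivation.add_apply] at l₃
  rw [K.lie_ξ] at l₁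
  have l₄ := congrArg (C.D X) l₂
  simp only [map_sub, C.D_mul, K.D_gp, K.D_ξ_ric, C.D_two, hV.D_a, K.η_ξ] at h₀
  apply eq_of_two_mul
  linear_combination -h₀ + h₁ + h₂ - l₁ - l₄ + l₃

lemma eq_zero (hV : K.IsSoliton V a m) {n : ℕ} (hn : n ≠ 0) (hd : C.dim = 2 * n + 1) : a = 0 := by
  have h : a • (LinearMap.id - K.η.smulRight K.ξ) = 0 := by
    ext X
    refine C.g_ext fun Y ↦ ?_
    have := hV.mul_gp X Y
    rw [gp_apply] at this
    simpa [K.ξ_g] using this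
  have h' := congrArg C.tr h
  rw [map_smul, map_sub, C.tr_id, C.tr_smulRight, K.η_ξ, hd, map_zero, smul_eq_mul] at h'
  have h'' : ((2 * n : ℝ)⁻¹) • ((2 * n : ℝ) • a) = 0 := by
    rw [Algebra.smul_def (2 * n : ℝ), map_mul, map_natCast, map_ofNat]
    push_cast at h'
    rw [show (2 : F) * n * a = a * (2 * n + 1 - 1) by ring, h', smul_zero]
  rwa [smul_smul, inv_mul_cancel₀ (by positivity), one_smul] at h''

end IsSoliton

end Kenmotsu

end RiemannianCalculus

namespace RiemannianCalculus

namespace Kenmotsu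

variable {F 𝔛 : Type*} [CommRing F] [Algebra ℝ F] [AddCommGroup 𝔛]
    [Module ℝ 𝔛] [Module F 𝔛] [IsScalarTower ℝ F 𝔛]
variable {C : RiemannianCalculus F 𝔛} {K : C.Kenmotsu}

variable (K) in
/-- A field `W` transverse to `ξ`, invariant under the flow of `ξ` and transversally conformal, with
conformal factor `ρ` of gradient `P` and of transverse Hessian `4 ric`. -/
structure IsConformal (W P : 𝔛) (ρ : F) : Prop where
  η_W : K.η W = 0
  η_P : K.η P = 0
  lie_W_ξ : C.lie W K.ξ = 0
  D_W_gp : ∀ X Y, C.D W (K.gp X Y)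
    = K.gp (C.lie W X) Y + K.gp X (C.lie W Y) + 2 * ρ * K.gp X Y
  g_P : ∀ X, C.g P X = C.D X ρ
  tn_P : ∀ X, K.tn X P = (4 : F) • K.ricOp X - (2 * K.η X) • P

namespace IsSoliton

variable {V : 𝔛} {m : F}

lemma η_grad (hV : K.IsSoliton V 0 m) : K.η (grad K V 0) = 0 := by
  rw [← K.g_ξ, hV.g_grad, hV.D_ξ_η]

lemma nab_grad (hV : K.IsSoliton V 0 m) (X : 𝔛) : C.nab X (grad K V 0)
    = (-2 : F) • K.ricOp X - C.D X (K.η V) • K.ξ - K.η X • grad K V 0 := by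
  refine C.g_ext fun Y ↦ ?_
  simp only [hV.g_nab_grad, map_sub, map_smul, LinearMap.sub_apply, LinearMap.smul_apply,
    K.g_ricOp, K.ξ_g, hV.g_grad, smul_eq_mul]
  ring

lemma tn_grad (hV : K.IsSoliton V 0 m) (X : 𝔛) : K.tn X (grad K V 0)
    = (-2 : F) • K.ricOp X - (2 * K.η X) • grad K V 0 := by
  rw [tn_apply, hV.nab_grad, C.g_symm X, hV.g_grad, hV.η_grad]
  module

lemma lie_ξ_V : C.lie K.ξ V = -grad K V 0 := by
  rw [grad]; module

lemma isConformal (hV : K.IsSoliton V 0 m) :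
    K.IsConformal ((2 : F) • V - (2 * K.η V) • K.ξ - grad K V 0) ((-2 : F) • grad K V 0)
      (2 * (m - K.η V)) where
  η_W := by
    simp only [map_sub, map_smul, K.η_ξ, hV.η_grad, smul_eq_mul]; ring
  η_P := by rw [map_smul, hV.η_grad, smul_zero]
  lie_W_ξ := by
    rw [C.lie_swap, C.lie_sub, C.lie_sub, C.lie_smul, C.lie_smul, lie_ξ_V, K.lie_ξ, K.lie_ξ,
      K.tn_ξ, hV.tn_grad, C.D_mul, C.D_two, hV.D_ξ_η, K.η_ξ,
      show K.ricOp K.ξ = 0 from C.g_ext fun Y ↦ by rw [K.g_ricOp, K.ξ_ric]; simp]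
    module
  D_W_gp X Y := by
    set W := (2 : F) • V - (2 * K.η V) • K.ξ - grad K V 0 with hW
    have hη : K.η W = 0 := by
      simp only [hW, map_sub, map_smul, K.η_ξ, hV.η_grad, smul_eq_mul]; ring
    have h₁ := hV.eq X Y
    have h₂ := K.lieDeriv_ξ_g X Y
    have h₃ : C.lieDeriv W (fun X Y ↦ C.g X Y) X Y = 4 * (m - K.η V) * K.gp X Y := by
      rw [C.lieDeriv_g] at h₁ h₂
      rw [C.lieDeriv_g, hW]
      simp only [map_sub, C.nab_smul, C.D_mul, C.D_two, map_add, LinearMap.add_apply,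
        LinearMap.sub_apply, map_smul, LinearMap.smul_apply, smul_eq_mul, hV.g_nab_grad,
        K.ξ_g, C.g_symm Y X, K.ric_symm Y X]
      rw [gp_apply] at h₂ ⊢
      linear_combination 2 * h₁ - 2 * K.η V * h₂
    have h₄ := K.η_lie W X
    have h₅ := K.η_lie W Y
    rw [hη, map_zero, sub_zero] at h₄ h₅
    simp only [lieDeriv] at h₃
    simp only [gp_apply, map_sub, C.D_mul, h₄, h₅] at h₃ ⊢
    linear_combination h₃
  g_P X := by
    simp only [map_smul, LinearMap.smul_apply, hV.g_grad, C.D_mul, C.D_two, map_sub, hV.D_m,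
      smul_eq_mul]
    ring
  tn_P X := by
    rw [K.isTorsionFree_tn.smul, hV.tn_grad, map_neg, C.D_two]; module

end IsSoliton

namespace IsConformal

variable {W P : 𝔛} {ρ : F}

lemma η_lie (h : K.IsConformal W P ρ) (X : 𝔛) : K.η (C.lie W X) = C.D W (K.η X) := by
  rw [K.η_lie, h.η_W, map_zero, sub_zero]

variable (K W) in
/-- The Lie derivative of the connection `tn` along `W`. -/
def lieTn (X Y : 𝔛) : 𝔛 :=
  C.lie W (K.tn X Y) - K.tn (C.lie W X) Y - K.tn X (C.lie W Y)

lemma lieTn_symm (X Y : 𝔛) : lieTn K W X Y = lieTn K W Y X := by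
  have h := C.jacobi W X Y
  have e := K.isTorsionFree_tn.sub X Y
  rw [← e, C.lie_sub, ← K.isTorsionFree_tn.sub (C.lie W X), ← K.isTorsionFree_tn.sub X] at h
  simp only [lieTn]
  linear_combination (norm := module) h

lemma gp_lieTn_add (h : K.IsConformal W P ρ) (X Y Z : 𝔛) :
    K.gp (lieTn K W X Y) Z + K.gp Y (lieTn K W X Z) = 2 * C.D X ρ * K.gp Y Z := by
  have h₁ := C.D_lie W X (K.gp Y Z)
  have h₂ := h.η_lie X
  simp only [h.D_W_gp, K.D_gp, map_add, C.D_mul, C.D_two, h₂] at h₁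
  simp only [lieTn, map_sub, LinearMap.sub_apply]
  linear_combination -h₁

lemma gp_lieTn (h : K.IsConformal W P ρ) (X Y Z : 𝔛) : K.gp (lieTn K W X Y) Z
    = C.D X ρ * K.gp Y Z + C.D Y ρ * K.gp X Z - C.D Z ρ * K.gp X Y := by
  have h₁ := h.gp_lieTn_add X Y Z
  have h₂ := h.gp_lieTn_add Y X Z
  have h₃ := h.gp_lieTn_add Z X Y
  rw [lieTn_symm Y X, K.gp_symm X] at h₂
  rw [lieTn_symm Z X, lieTn_symm Z Y, K.gp_symm _ Y, K.gp_symm X] at h₃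
  apply eq_of_two_mul
  linear_combination h₁ + h₂ - h₃

lemma η_lieTn (h : K.IsConformal W P ρ) (X Y : 𝔛) : K.η (lieTn K W X Y) = 0 := by
  simp only [lieTn, map_sub, h.η_lie, ← K.D_η', C.D_lie]
  ring

lemma lieTn_eq (h : K.IsConformal W P ρ) (X Y : 𝔛) : lieTn K W X Y
    = C.D X ρ • (Y - K.η Y • K.ξ) + C.D Y ρ • (X - K.η X • K.ξ) - K.gp X Y • P := by
  refine C.g_ext fun Z ↦ ?_
  have h₁ := h.gp_lieTn X Y Z
  rw [gp_apply, h.η_lieTn] at h₁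
  simp only [map_add, map_sub, map_smul, LinearMap.add_apply, LinearMap.sub_apply,
    LinearMap.smul_apply, smul_eq_mul, K.ξ_g, h.g_P]
  rw [gp_apply K Y Z, gp_apply K X Z] at h₁
  linear_combination h₁

variable (K W) in
/-- The Lie derivative of `φ` along `W`. -/
def lieφ : 𝔛 →ₗ[F] 𝔛 where
  toFun X := C.lie W (K.φ X) - K.φ (C.lie W X)
  map_add' X Y := by simp only [map_add, C.lie_add]; abel
  map_smul' f X := by
    simp only [map_smul, C.lie_smul, map_add, RingHom.id_apply]; module

lemma lieφ_apply (X : 𝔛) : lieφ K W X = C.lie W (K.φ X) - K.φ (C.lie W X) := rfl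

lemma η_lieφ (h : K.IsConformal W P ρ) (X : 𝔛) : K.η (lieφ K W X) = 0 := by
  simp [lieφ_apply, h.η_lie]

lemma φ_lieφ (h : K.IsConformal W P ρ) (X : 𝔛) :
    K.φ (lieφ K W X) = -lieφ K W (K.φ X) := by
  simp only [lieφ_apply, map_sub, K.φ_φ, C.lie_add, C.lie_neg, C.lie_smul, h.lie_W_ξ, h.η_lie]
  module

lemma g_lieφ (h : K.IsConformal W P ρ) (X Y : 𝔛) :
    C.g (lieφ K W X) Y = -C.g X (lieφ K W Y) := by
  have e : ∀ X Y, K.gp (K.φ X) Y = -K.gp X (K.φ Y) := fun X Y ↦ by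
    rw [gp_apply, gp_apply, K.η_φ, K.η_φ, K.g_φ_left]; ring
  have h₁ := h.D_W_gp (K.φ X) Y
  have h₂ := h.D_W_gp X (K.φ Y)
  have h₃ := congrArg (C.D W) (e X Y)
  have h₄ : K.gp (lieφ K W X) Y = -K.gp X (lieφ K W Y) := by
    rw [map_neg] at h₃
    simp only [lieφ_apply, map_sub, LinearMap.sub_apply, e]
    linear_combination -h₁ - h₂ + h₃ - e X (C.lie W Y) - 2 * ρ * e X Y
  rw [gp_apply, gp_apply, h.η_lieφ, h.η_lieφ] at h₄
  linear_combination h₄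

/-- The derivative of `lieφ`. -/
lemma tn_lieφ (X Z : 𝔛) : K.tn X (lieφ K W Z)
    = lieφ K W (K.tn X Z) + (K.φ (lieTn K W X Z) - lieTn K W X (K.φ Z)) := by
  simp only [lieφ_apply, lieTn, map_sub, K.tn_φ]
  module

end IsConformal

end Kenmotsu

end RiemannianCalculus

namespace RiemannianCalculus

namespace Kenmotsu

variable {F 𝔛 : Type*} [CommRing F] [Algebra ℝ F] [AddCommGroup 𝔛]
    [Module ℝ 𝔛] [Module F 𝔛] [IsScalarTower ℝ F 𝔛]
variable {C : RiemannianCalculus F 𝔛} {K : C.Kenmotsu}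

variable (K) in
lemma tr_φ : C.tr K.φ = 0 := by
  apply eq_zero_of_eq_neg
  rw [← map_neg]
  exact C.tr_adjoint fun X Y ↦ by simp [K.g_φ_left]

variable (K) in
lemma tr_φ_ricOp : C.tr (K.φ ∘ₗ K.ricOp) = 0 := by
  have h : C.tr (K.φ ∘ₗ K.ricOp) = C.tr (-(K.ricOp ∘ₗ K.φ)) := by
    refine C.tr_adjoint fun X Y ↦ ?_
    simp only [LinearMap.comp_apply, LinearMap.neg_apply, map_neg, C.g_symm X, K.g_φ_left,
      K.g_ricOp, K.ric_φ_left, K.ric_symm X]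
  exact eq_zero_of_eq_neg (h.trans (by rw [map_neg, C.tr_comp_comm]))

namespace IsConformal

variable {W P : 𝔛} {ρ : F}

variable (K W) in
/-- The covariant derivative of `lieφ`. -/
def tnφ (X Z : 𝔛) : 𝔛 := K.φ (lieTn K W X Z) - lieTn K W X (K.φ Z)

lemma tnφ_eq (h : K.IsConformal W P ρ) (Y Z : 𝔛) : tnφ K W Y Z = C.D Z ρ • K.φ Y
    - K.gp Y Z • K.φ P - C.D (K.φ Z) ρ • (Y - K.η Y • K.ξ) + K.gp Y (K.φ Z) • P := by
  simp only [tnφ, h.lieTn_eq, map_add, map_sub, map_smul, K.φ_ξ, K.η_φ]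
  module

lemma tn_hess (h : K.IsConformal W P ρ) (X Z : 𝔛) :
    C.D X (C.D Z ρ) = C.D (K.tn X Z) ρ + 4 * K.ric X Z := by
  have h₁ := K.D_gp X P Z
  simp only [h.tn_P, map_sub, map_smul, LinearMap.sub_apply, LinearMap.smul_apply, smul_eq_mul,
    gp_apply, h.η_P, K.η_ricOp, h.g_P, K.g_ricOp, zero_mul, sub_zero] at h₁
  linear_combination h₁

lemma tn_tnφ (h : K.IsConformal W P ρ) (X Y Z : 𝔛) :
    K.tn X (tnφ K W Y Z) - tnφ K W (K.tn X Y) Z - tnφ K W Y (K.tn X Z)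
      = (4 : F) • (K.ric X Z • K.φ Y - K.gp Y Z • K.φ (K.ricOp X)
        - K.ric X (K.φ Z) • (Y - K.η Y • K.ξ) + K.gp Y (K.φ Z) • K.ricOp X) := by
  simp only [h.tnφ_eq, map_add, map_sub, K.isTorsionFree_tn.smul, K.tn_φ, K.tn_ξ, h.tn_P,
    h.tn_hess, K.D_gp, K.D_η', map_smul]
  module

lemma curv_lieφ (h : K.IsConformal W P ρ) (X Y Z : 𝔛) :
    C.curv K.tn X Y (lieφ K W Z) - lieφ K W (C.curv K.tn X Y Z)
      = (4 : F) • (K.ric X Z • K.φ Y - K.gp Y Z • K.φ (K.ricOp X)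
        - K.ric X (K.φ Z) • (Y - K.η Y • K.ξ) + K.gp Y (K.φ Z) • K.ricOp X
        - (K.ric Y Z • K.φ X - K.gp X Z • K.φ (K.ricOp Y)
        - K.ric Y (K.φ Z) • (X - K.η X • K.ξ) + K.gp X (K.φ Z) • K.ricOp Y)) := by
  have e : ∀ X Z, K.tn X (lieφ K W Z) = lieφ K W (K.tn X Z) + tnφ K W X Z := tn_lieφ
  have hl : tnφ K W (C.lie X Y) Z = tnφ K W (K.tn X Y) Z - tnφ K W (K.tn Y X) Z := by
    rw [← K.isTorsionFree_tn.sub]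
    simp only [h.tnφ_eq, map_sub, LinearMap.sub_apply]; module
  have h₁ := h.tn_tnφ X Y Z
  have h₂ := h.tn_tnφ Y X Z
  simp only [curv, e, map_add, map_sub, hl]
  linear_combination (norm := module) h₁ - h₂

lemma tr_curvEnd_lieφ (h : K.IsConformal W P ρ) (Y Z : 𝔛) :
    C.tr (K.isTorsionFree_tn.curvEnd Y Z ∘ₗ lieφ K W) = 0 := by
  set A := K.isTorsionFree_tn.curvEnd Y Z
  have hA : A ∘ₗ K.φ = K.φ ∘ₗ A := by ext X; exact K.curv_φ Y Z X
  have h₁ : lieφ K W = -(K.φ ∘ₗ K.φ ∘ₗ lieφ K W) := by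
    ext X
    simp [K.φ_φ, h.η_lieφ]
  have h₂ : K.φ ∘ₗ lieφ K W = -(lieφ K W ∘ₗ K.φ) := by
    ext X
    exact h.φ_lieφ X
  have h₃ : C.tr (A ∘ₗ K.φ ∘ₗ K.φ ∘ₗ lieφ K W) = -C.tr (A ∘ₗ K.φ ∘ₗ K.φ ∘ₗ lieφ K W) := by
    nth_rw 1 [h₂]
    rw [← map_neg, LinearMap.comp_neg, LinearMap.comp_neg, map_neg, map_neg,
      ← LinearMap.comp_assoc, ← LinearMap.comp_assoc, C.tr_comp_comm, ← LinearMap.comp_assoc,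
      ← LinearMap.comp_assoc, ← hA]
    simp only [LinearMap.comp_assoc]
  rw [h₁, LinearMap.comp_neg, map_neg, eq_zero_of_eq_neg h₃, neg_zero]

lemma tr_lieφ_curvLeft (h : K.IsConformal W P ρ) (Y Z : 𝔛) :
    C.tr (lieφ K W ∘ₗ K.isTorsionFree_tn.curvLeft Y Z) = 0 := by
  have h₁ : C.tr (K.isTorsionFree_tn.curvLeft Z Y ∘ₗ lieφ K W)
      = -C.tr (lieφ K W ∘ₗ K.isTorsionFree_tn.curvLeft Y Z) := by
    rw [← map_neg]
    refine C.tr_adjoint fun X V ↦ ?_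
    change C.g (C.curv K.tn (lieφ K W X) Z Y) V = C.g X (-lieφ K W (C.curv K.tn V Y Z))
    rw [K.pair_symm, K.g_curv, C.g_symm, h.g_lieφ, map_neg, neg_neg, curv_swap, map_neg, map_neg]
  have h₂ : K.isTorsionFree_tn.curvLeft Y Z ∘ₗ lieφ K W
      = K.isTorsionFree_tn.curvLeft Z Y ∘ₗ lieφ K W
        - K.isTorsionFree_tn.curvEnd Y Z ∘ₗ lieφ K W := by
    ext X
    change C.curv K.tn (lieφ K W X) Y Z
      = C.curv K.tn (lieφ K W X) Z Y - C.curv K.tn Y Z (lieφ K W X)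
    have := K.isTorsionFree_tn.bianchi (lieφ K W X) Y Z
    rw [curv_swap Z] at this
    linear_combination (norm := module) this
  apply eq_zero_of_eq_neg
  nth_rw 1 [C.tr_comp_comm]
  rw [h₂, map_sub, h.tr_curvEnd_lieφ, sub_zero, h₁]

lemma ric_lieφ (h : K.IsConformal W P ρ) {n : ℕ} (hd : C.dim = 2 * n + 1) (Y Z : 𝔛) :
    K.ric Y (lieφ K W Z)
      = 4 * ((2 * n - 4) * K.ric Y (K.φ Z) + C.tr K.ricOp * K.gp Y (K.φ Z)) := by
  have h₁ : K.isTorsionFree_tn.curvLeft Y (lieφ K W Z)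
      - lieφ K W ∘ₗ K.isTorsionFree_tn.curvLeft Y Z
      = (4 : F) • ((K.ric.flip Z).smulRight (K.φ Y) - K.gp Y Z • (K.φ ∘ₗ K.ricOp)
        - (K.ric.flip (K.φ Z)).smulRight (Y - K.η Y • K.ξ) + K.gp Y (K.φ Z) • K.ricOp
        - (K.ric Y Z • K.φ - (K.gp.flip Z).smulRight (K.φ (K.ricOp Y))
        - K.ric Y (K.φ Z) • (LinearMap.id - K.η.smulRight K.ξ)
        + (K.gp.flip (K.φ Z)).smulRight (K.ricOp Y))) := by
    ext X
    exact h.curv_lieφ X Y Z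
  have h₂ := congrArg C.tr h₁
  simp only [map_sub, map_add, map_smul, C.tr_smulRight, h.tr_lieφ_curvLeft, K.tr_φ,
    K.tr_φ_ricOp, C.tr_id, hd, LinearMap.flip_apply, gp_apply, K.η_φ, K.η_ricOp, K.g_φ_left,
    K.g_ricOp, K.ric_φ_left, K.ξ_ric, K.η_ξ,
    smul_eq_mul] at h₂
  rw [IsTorsionFree.ric_apply, gp_apply, K.η_φ]
  push_cast at h₂
  linear_combination h₂

theorem tr_ricOp_eq_zero (h : K.IsConformal W P ρ) {n : ℕ} (hd : C.dim = 2 * n + 1)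
    (hn : n ≠ 1) : C.tr K.ricOp = 0 := by
  have h₁ : ∀ Y Z, (2 * n - 4) * K.ric Y (K.φ Z) + C.tr K.ricOp * K.gp Y (K.φ Z) = 0 := by
    intro Y Z
    have e₁ := h.ric_lieφ hd Y Z
    have e₂ := h.ric_lieφ hd (K.φ Y) (K.φ Z)
    have e₃ : K.ric (K.φ Y) (lieφ K W (K.φ Z)) = -K.ric Y (lieφ K W Z) := by
      rw [← K.ric_φ_φ Y, h.φ_lieφ, map_neg, neg_neg]
    rw [e₃, K.ric_φ_φ, gp_apply, K.g_φ_φ, K.η_φ, K.η_φ] at e₂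
    rw [gp_apply, K.η_φ] at e₁ ⊢
    apply eq_of_two_mul
    apply eq_of_two_mul
    apply eq_of_two_mul
    linear_combination -e₁ - e₂
  have h₂ : (2 * n - 4 : F) • K.ricOp + C.tr K.ricOp • (LinearMap.id - K.η.smulRight K.ξ) = 0 := by
    ext Y
    refine C.g_ext fun Z ↦ ?_
    have e := h₁ Y (K.φ Z)
    rw [K.φ_φ] at e
    simp only [gp_apply, map_add, map_neg, map_smul, K.ric_ξ, K.g_ξ, K.η_ξ, smul_eq_mul] at e
    simp only [LinearMap.add_apply, LinearMap.smul_apply, LinearMap.sub_apply, LinearMap.id_apply,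
      LinearMap.smulRight_apply, map_add, map_smul, map_sub, K.g_ricOp, K.ξ_g, smul_eq_mul,
      LinearMap.zero_apply, map_zero]
    linear_combination -e
  have h₃ := congrArg C.tr h₂
  rw [map_add, map_smul, map_smul, map_sub, C.tr_id, C.tr_smulRight, K.η_ξ, hd, map_zero] at h₃
  have h₄ : ((4 * n - 4 : ℝ)⁻¹) • ((4 * n - 4 : ℝ) • C.tr K.ricOp) = 0 := by
    rw [Algebra.smul_def (4 * n - 4 : ℝ), map_sub, map_mul, map_natCast, map_ofNat]
    push_cast at h₃
    simp only [smul_eq_mul] at h₃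
    rw [show (4 * n - 4 : F) * C.tr K.ricOp = 0 by linear_combination h₃, smul_zero]
  have hn' : (4 * n - 4 : ℝ) ≠ 0 := fun h0 ↦ hn (by exact_mod_cast (by linarith : (n : ℝ) = 1))
  rwa [smul_smul, inv_mul_cancel₀ hn', one_smul] at h₄

end IsConformal

theorem IsSoliton.tr_ricOp_eq_zero {V : 𝔛} {a m : F} (hV : K.IsSoliton V a m) {n : ℕ}
    (hd : C.dim = 2 * n + 1) (hn₀ : n ≠ 0) (hn₁ : n ≠ 1) : C.tr K.ricOp = 0 := by
  obtain rfl := hV.eq_zero hn₀ hd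
  exact hV.isConformal.tr_ricOp_eq_zero hd hn₁

end Kenmotsu

end RiemannianCalculus

section Fields

variable {E : Type*} [NormedAddCommGroup E] [NormedSpace ℝ E]
  {H : Type*} [TopologicalSpace H] (I : ModelWithCorners ℝ E H)
  (M : Type*) [TopologicalSpace M] [ChartedSpace H M] [IsManifold I ∞ M]

/-- Smooth functions. -/
abbrev SmoothFn : Type _ := C^∞⟮I, M; 𝓘(ℝ, ℝ), ℝ⟯

/-- Smooth vector fields. -/
abbrev SmoothVF : Type _ := Cₛ^∞⟮I; E, (TangentSpace I : M → Type _)⟯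

variable {I M}

lemma SmoothVF.isSmoothField (X : SmoothVF I M) : IsSmoothField I (X : Π x, TangentSpace I x) :=
  X.contMDiff

/-- The bundled version of a smooth vector field. -/
def IsSmoothField.toVF {X : Π x : M, TangentSpace I x} (hX : IsSmoothField I X) : SmoothVF I M :=
  ⟨X, hX⟩

instance : SMul (SmoothFn I M) (SmoothVF I M) where
  smul f X := ⟨fun x ↦ f x • X x, f.contMDiff.smul_section X.contMDiff⟩

lemma SmoothVF.smul_apply (f : SmoothFn I M) (X : SmoothVF I M) (x : M) :
    (f • X) x = f x • X x := rfl

instance : Module (SmoothFn I M) (SmoothVF I M) where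
  one_smul X := by ext x; exact one_smul ℝ (X x)
  mul_smul f h X := by ext x; exact mul_smul (f x) (h x) (X x)
  smul_zero f := by ext x; exact smul_zero (f x)
  smul_add f X Y := by ext x; exact smul_add (f x) (X x) (Y x)
  add_smul f h X := by ext x; exact add_smul (f x) (h x) (X x)
  zero_smul X := by ext x; exact zero_smul ℝ (X x)

instance : IsScalarTower ℝ (SmoothFn I M) (SmoothVF I M) where
  smul_assoc r f X := by ext x; exact smul_assoc r (f x) (X x)

lemma SmoothVF.sum_apply {ι : Type*} (s : Finset ι) (X : ι → SmoothVF I M) (y : M) :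
    (∑ i ∈ s, X i) y = ∑ i ∈ s, X i y := by
  classical
  induction s using Finset.induction_on with
  | empty => rfl
  | insert a s ha h => rw [Finset.sum_insert ha, Finset.sum_insert ha, ← h]; rfl

lemma SmoothFn.sum_apply {ι : Type*} (s : Finset ι) (f : ι → SmoothFn I M) (y : M) :
    (∑ i ∈ s, f i) y = ∑ i ∈ s, f i y := by
  classical
  induction s using Finset.induction_on with
  | empty => rfl
  | insert a s ha h => rw [Finset.sum_insert ha, Finset.sum_insert ha, ← h]; rfl

lemma contMDiff_dirDeriv (X : SmoothVF I M) (f : SmoothFn I M) :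
    ContMDiff I 𝓘(ℝ, ℝ) ∞ (dirDeriv I X f) := by
  have h := (f.contMDiff.contMDiff_tangentMap (m := ∞) (by simp)).comp X.contMDiff
  exact (contMDiff_snd_tangentBundle_modelSpace ℝ 𝓘(ℝ, ℝ)).comp h

/-- The action of smooth vector fields on smooth functions. -/
def SmoothVF.deriv : SmoothVF I M →ₗ[SmoothFn I M] Derivation ℝ (SmoothFn I M) (SmoothFn I M) where
  toFun X := Derivation.mk'
    { toFun := fun f ↦ ⟨dirDeriv I X f, contMDiff_dirDeriv X f⟩
      map_add' := fun f h ↦ by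
        ext x
        exact congrArg (fun L ↦ L (X x)) (mvfderiv_add f.mdifferentiableAt h.mdifferentiableAt)
      map_smul' := fun r f ↦ by
        ext x
        have h := congrArg (fun L ↦ L (X x)) (mvfderiv_smul (I := I) (x := x) (a := fun _ ↦ r)
          mdifferentiableAt_const f.mdifferentiableAt)
        rw [mvfderiv_const] at h
        refine h.trans ?_
        simp
        rfl }
    (fun f h ↦ by
      ext x
      exact congrArg (fun L ↦ L (X x)) (mvfderiv_mul f.mdifferentiableAt h.mdifferentiableAt))
  map_add' X Y := by
    ext f x
    exact map_add (mvfderiv I f x) (X x) (Y x)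
  map_smul' h X := by
    ext f x
    exact map_smul (mvfderiv I f x) (h x) (X x)

variable (I M) in
lemma isManifold_minSmoothness : IsManifold I (minSmoothness ℝ 3) M := by
  rw [minSmoothness_of_isRCLikeNormedField]; exact IsManifold.of_le (n := ∞) ENat.LEInfty.out

variable [CompleteSpace E]

/-- The Lie bracket of smooth vector fields. -/
def SmoothVF.lie (X Y : SmoothVF I M) : SmoothVF I M where
  toFun := mlieBracket I X Y
  contMDiff_toFun := by
    have := isManifold_minSmoothness I M
    have : IsManifold I ((⊤ : ℕ∞) + 1) M := ‹IsManifold I ∞ M›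
    exact ContDiff.mlieBracket_vectorField (m := ⊤) (n := ⊤) X.contMDiff Y.contMDiff (by simp)

lemma SmoothVF.lie_swap (X Y : SmoothVF I M) : SmoothVF.lie X Y = -SmoothVF.lie Y X := by
  ext x; exact mlieBracket_swap_apply

lemma SmoothVF.lie_add (X Y Z : SmoothVF I M) :
    SmoothVF.lie X (Y + Z) = SmoothVF.lie X Y + SmoothVF.lie X Z := by
  ext x; exact mlieBracket_add_right Y.mdifferentiableAt Z.mdifferentiableAt

lemma SmoothVF.lie_smul (X : SmoothVF I M) (f : SmoothFn I M) (Y : SmoothVF I M) :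
    SmoothVF.lie X (f • Y) = SmoothVF.deriv X f • Y + f • SmoothVF.lie X Y := by
  ext x; exact mlieBracket_smul_right f.mdifferentiableAt Y.mdifferentiableAt

lemma SmoothVF.jacobi (X Y Z : SmoothVF I M) : SmoothVF.lie X (SmoothVF.lie Y Z) =
    SmoothVF.lie (SmoothVF.lie X Y) Z + SmoothVF.lie Y (SmoothVF.lie X Z) := by
  ext x
  have := isManifold_minSmoothness I M
  have h : minSmoothness ℝ 2 ≤ ∞ := by
    rw [minSmoothness_of_isRCLikeNormedField]; exact ENat.LEInfty.out
  exact leibniz_identity_mlieBracket_apply ((X.contMDiff x).of_le h) ((Y.contMDiff x).of_le h)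
    ((Z.contMDiff x).of_le h)

end Fields

section Metric

variable {E : Type*} [NormedAddCommGroup E] [NormedSpace ℝ E]
  {H : Type*} [TopologicalSpace H] {I : ModelWithCorners ℝ E H}
  {M : Type*} [TopologicalSpace M] [ChartedSpace H M] [IsManifold I ∞ M]
  [RiemannianBundle (fun x : M ↦ TangentSpace I x)]
  [IsContMDiffRiemannianBundle I ∞ E (fun x : M ↦ TangentSpace I x)]

lemma contMDiffOn_metric {X Y : Π y : M, TangentSpace I y} {u : Set M}
    (hX : ContMDiffOn I I.tangent ∞ (fun y ↦ (⟨y, X y⟩ : TangentBundle I M)) u)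
    (hY : ContMDiffOn I I.tangent ∞ (fun y ↦ (⟨y, Y y⟩ : TangentBundle I M)) u) :
    ContMDiffOn I 𝓘(ℝ, ℝ) ∞ (metric I X Y) u :=
  ContMDiffOn.inner_bundle (IB := I) (F := E) (E := fun x : M ↦ TangentSpace I x)
    (b := fun x ↦ x) hX hY

/-- The metric on smooth vector fields. -/
def SmoothVF.g : SmoothVF I M →ₗ[SmoothFn I M] SmoothVF I M →ₗ[SmoothFn I M] SmoothFn I M :=
  LinearMap.mk₂ _ (fun X Y ↦ ⟨metric I X Y, contMDiffOn_univ.1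
      (contMDiffOn_metric X.contMDiff.contMDiffOn Y.contMDiff.contMDiffOn)⟩)
    (fun X X' Y ↦ by ext x; exact inner_add_left (X x) (X' x) (Y x))
    (fun f X Y ↦ by ext x; exact real_inner_smul_left (X x) (Y x) (f x))
    (fun X Y Y' ↦ by ext x; exact inner_add_right (X x) (Y x) (Y' x))
    (fun f X Y ↦ by ext x; exact real_inner_smul_right (X x) (Y x) (f x))

lemma SmoothVF.g_apply (X Y : SmoothVF I M) (x : M) :
    SmoothVF.g X Y x = inner ℝ (X x) (Y x) := rfl

lemma contMDiffOn_gramSchmidt {ι : Type*} [LinearOrder ι] [LocallyFiniteOrderBot ι]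
    [WellFoundedLT ι] {s : ι → Π y : M, TangentSpace I y} {u : Set M}
    (hs : ∀ i, ContMDiffOn I I.tangent ∞ (fun y ↦ (⟨y, s i y⟩ : TangentBundle I M)) u)
    (hli : ∀ y ∈ u, LinearIndependent ℝ (fun i ↦ s i y)) (i : ι) :
    ContMDiffOn I I.tangent ∞ (fun y ↦ (⟨y, InnerProductSpace.gramSchmidt ℝ (fun j ↦ s j y) i⟩ :
      TangentBundle I M)) u := by
  induction i using WellFoundedLT.induction with
  | ind i ih =>
    have h : ContMDiffOn I I.tangent ∞ (fun y ↦ (⟨y, (s i - fun y ↦ ∑ j ∈ Finset.Iio i,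
        ((inner ℝ (InnerProductSpace.gramSchmidt ℝ (fun j ↦ s j y) j) (s i y) : ℝ) /
          inner ℝ (InnerProductSpace.gramSchmidt ℝ (fun j ↦ s j y) j)
            (InnerProductSpace.gramSchmidt ℝ (fun j ↦ s j y) j)) •
          InnerProductSpace.gramSchmidt ℝ (fun j ↦ s j y) j) y⟩ : TangentBundle I M)) u := by
      refine (hs i).sub_section (ContMDiffOn.sum_section fun j hj ↦ ?_)
      have hj' := ih j (Finset.mem_Iio.1 hj)
      refine ContMDiffOn.smul_section ?_ hj'
      refine (contMDiffOn_metric hj' (hs i)).div₀ (contMDiffOn_metric hj' hj') ?_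
      intro y hy
      exact inner_self_ne_zero.2 (InnerProductSpace.gramSchmidt_ne_zero j (hli y hy))
    refine h.congr fun y hy ↦ ?_
    congr 1
    rw [InnerProductSpace.gramSchmidt_def]
    simp [Submodule.starProjection_singleton]

end Metric

section Frames

open Topology

variable {E : Type*} [NormedAddCommGroup E] [NormedSpace ℝ E] [FiniteDimensional ℝ E]
  {H : Type*} [TopologicalSpace H] {I : ModelWithCorners ℝ E H}
  {M : Type*} [TopologicalSpace M] [T2Space M] [ChartedSpace H M] [IsManifold I ∞ M]

lemma exists_smoothFn_eventuallyEq_one (x : M) {u : Set M} (hu : u ∈ 𝓝 x) :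
    ∃ χ : SmoothFn I M, (∀ᶠ y in 𝓝 x, χ y = 1) ∧ tsupport χ ⊆ u := by
  obtain ⟨f, -, hf⟩ := (SmoothBumpFunction.nhds_basis_tsupport (I := I) x).mem_iff.1 hu
  exact ⟨⟨f, f.contMDiff⟩, f.eventuallyEq_one, hf⟩

/-- A vector field that is smooth near `x` agrees near `x` with a smooth vector field. -/
lemma exists_smoothVF_eventuallyEq {X : Π y : M, TangentSpace I y} {x : M} {u : Set M}
    (hu : u ∈ 𝓝 x) (hX : ContMDiffOn I I.tangent ∞ (fun y ↦ (⟨y, X y⟩ : TangentBundle I M)) u) :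
    ∃ Y : SmoothVF I M, ∀ᶠ y in 𝓝 x, Y y = X y := by
  obtain ⟨χ, hχ, hs⟩ := exists_smoothFn_eventuallyEq_one (I := I) x (interior_mem_nhds.2 hu)
  refine ⟨⟨(χ : M → ℝ) • X, ContMDiffOn.smul_section_of_tsupport χ.contMDiff.contMDiffOn
    isOpen_interior hs (hX.mono interior_subset)⟩, ?_⟩
  filter_upwards [hχ] with y hy
  change χ y • X y = X y
  rw [hy, one_smul]

lemma exists_smoothVF_extend {x : M} (v : TangentSpace I x) :
    ∃ Y : SmoothVF I M, ∀ᶠ y in 𝓝 x, Y y = FiberBundle.extend E v y := by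
  obtain ⟨s, hs, h⟩ := FiberBundle.exists_contMDiffOn_extend (k := ∞) I E v
  exact exists_smoothVF_eventuallyEq hs h

/-- A smooth vector field with a given value at `x`. -/
def extendVF {x : M} (v : TangentSpace I x) : SmoothVF I M := (exists_smoothVF_extend v).choose

lemma extendVF_eventuallyEq {x : M} (v : TangentSpace I x) :
    (extendVF v : Π y : M, TangentSpace I y) =ᶠ[𝓝 x]
      (FiberBundle.extend E v : Π y : M, TangentSpace I y) :=
  (exists_smoothVF_extend v).choose_spec

@[simp] lemma extendVF_apply {x : M} (v : TangentSpace I x) : extendVF v x = v := by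
  rw [(extendVF_eventuallyEq v).self_of_nhds]; simp

variable [RiemannianBundle (fun x : M ↦ TangentSpace I x)]
  [IsContMDiffRiemannianBundle I ∞ E (fun x : M ↦ TangentSpace I x)]

/-- A family of smooth vector fields, orthonormal near `x`. -/
lemma exists_orthonormal_frame (x : M) :
    ∃ e : Fin (Module.finrank ℝ E) → SmoothVF I M,
      ∀ᶠ y in 𝓝 x, Orthonormal ℝ (fun i ↦ e i y) := by
  let t := trivializationAt E (TangentSpace I : M → Type _) x
  have hu : t.baseSet ∈ 𝓝 x :=
    t.open_baseSet.mem_nhds (FiberBundle.mem_baseSet_trivializationAt E _ x)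
  have hf := t.isLocalFrameOn_localFrame_baseSet I ∞ (Module.finBasis ℝ E)
  set s := t.localFrame (Module.finBasis ℝ E)
  have hg := contMDiffOn_gramSchmidt (fun i ↦ hf.contMDiffOn i) fun y hy ↦ hf.linearIndependent hy
  have he : ∀ i, ContMDiffOn I I.tangent ∞ (fun y ↦
      (⟨y, InnerProductSpace.gramSchmidtNormed ℝ (fun j ↦ s j y) i⟩ : TangentBundle I M))
      t.baseSet := by
    intro i
    have hc : ContMDiffOn I 𝓘(ℝ, ℝ) ∞
        (fun y ↦ ‖InnerProductSpace.gramSchmidt ℝ (fun j ↦ s j y) i‖⁻¹) t.baseSet := by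
      refine ContMDiffOn.inv₀ (fun y hy ↦ ?_) fun y hy ↦ norm_ne_zero_iff.2
        (InnerProductSpace.gramSchmidt_ne_zero i (hf.linearIndependent hy))
      have h₀ := contMDiffOn_metric (hg i) (hg i) y hy
      have h₁ : metric I (fun y ↦ InnerProductSpace.gramSchmidt ℝ (fun j ↦ s j y) i)
          (fun y ↦ InnerProductSpace.gramSchmidt ℝ (fun j ↦ s j y) i) y ≠ 0 :=
        inner_self_ne_zero.2 (InnerProductSpace.gramSchmidt_ne_zero i (hf.linearIndependent hy))
      refine ((Real.contDiffAt_sqrt h₁).contMDiffAt.comp_contMDiffWithinAt y h₀).congr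
        (fun z _ ↦ ?_) ?_
      · exact norm_eq_sqrt_real_inner _
      · exact norm_eq_sqrt_real_inner _
    exact ContMDiffOn.smul_section hc (hg i)
  choose e he' using fun i ↦ exists_smoothVF_eventuallyEq hu (he i)
  refine ⟨e, ?_⟩
  filter_upwards [Filter.eventually_all.2 he', hu] with y hy hyu
  simp only [hy]
  exact InnerProductSpace.gramSchmidtNormed_orthonormal (hf.linearIndependent hyu)

/-- The orthonormal basis given by an orthonormal family of the right cardinality. -/
def onbOfOrthonormal {y : M} {v : Fin (Module.finrank ℝ E) → TangentSpace I y}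
    (h : Orthonormal ℝ v) : OrthonormalBasis (Fin (Module.finrank ℝ E)) ℝ (TangentSpace I y) :=
  OrthonormalBasis.mk h
    (h.linearIndependent.span_eq_top_of_card_eq_finrank' (Fintype.card_fin _)).ge

@[simp] lemma onbOfOrthonormal_apply {y : M} {v : Fin (Module.finrank ℝ E) → TangentSpace I y}
    (h : Orthonormal ℝ v) (i : Fin (Module.finrank ℝ E)) : onbOfOrthonormal h i = v i := by
  simp [onbOfOrthonormal]

lemma SmoothVF.apply_eq_sum {e : Fin (Module.finrank ℝ E) → SmoothVF I M} {y : M}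
    (h : Orthonormal ℝ (fun i ↦ e i y)) (Z : SmoothVF I M) :
    Z y = ∑ i, SmoothVF.g (e i) Z y • e i y := by
  have := (onbOfOrthonormal h).sum_repr' (Z y)
  simpa [SmoothVF.g_apply] using this.symm

lemma linearMap_apply_eq_sum (θ : SmoothVF I M →ₗ[SmoothFn I M] SmoothFn I M)
    {e : Fin (Module.finrank ℝ E) → SmoothVF I M} {x : M}
    (he : ∀ᶠ y in 𝓝 x, Orthonormal ℝ (fun i ↦ e i y)) (Z : SmoothVF I M) :
    θ Z x = ∑ i, SmoothVF.g (e i) Z x * θ (e i) x := by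
  obtain ⟨χ, hχ, hs⟩ := exists_smoothFn_eventuallyEq_one (I := I) x he
  have h : χ • Z = ∑ i, (χ * SmoothVF.g (e i) Z) • e i := by
    ext y
    rw [SmoothVF.sum_apply, SmoothVF.smul_apply]
    by_cases hy : y ∈ tsupport χ
    · rw [SmoothVF.apply_eq_sum (hs hy) Z, Finset.smul_sum]
      exact Finset.sum_congr rfl fun i _ ↦ smul_smul _ _ _
    · have h0 : χ y = 0 := image_eq_zero_of_notMem_tsupport hy
      rw [h0, zero_smul]
      refine (Finset.sum_eq_zero fun i _ ↦ ?_).symm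
      change (χ y * SmoothVF.g (e i) Z y) • e i y = 0
      rw [h0, zero_mul, zero_smul]
  have h' := congrArg (fun f : SmoothFn I M ↦ f x) (congrArg θ h)
  simp only [map_smul, map_sum, SmoothFn.sum_apply, smul_eq_mul, ContMDiffMap.coe_mul,
    Pi.mul_apply, hχ.self_of_nhds, one_mul] at h'
  exact h'

/-- A linear map on vector fields is tensorial. -/
lemma linearMap_congr (θ : SmoothVF I M →ₗ[SmoothFn I M] SmoothFn I M) {x : M}
    {Y Z : SmoothVF I M} (h : Y x = Z x) : θ Y x = θ Z x := by
  obtain ⟨e, he⟩ := exists_orthonormal_frame (I := I) x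
  rw [linearMap_apply_eq_sum θ he, linearMap_apply_eq_sum θ he]
  simp only [SmoothVF.g_apply, h]

lemma endo_congr (A : SmoothVF I M →ₗ[SmoothFn I M] SmoothVF I M) {x : M}
    {Y Z : SmoothVF I M} (h : Y x = Z x) : A Y x = A Z x := by
  refine ext_inner_right ℝ fun v ↦ ?_
  have := linearMap_congr ((SmoothVF.g.flip (extendVF v)).comp A) h
  simpa [SmoothVF.g_apply] using this

lemma exists_sharp (θ : SmoothVF I M →ₗ[SmoothFn I M] SmoothFn I M) :
    ∃ X : SmoothVF I M, (∀ Z, SmoothVF.g X Z = θ Z) ∧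
      ∀ x, X x = ∑ i, θ (extendVF (onb I x i)) x • onb I x i := by
  set X : Π x : M, TangentSpace I x := fun x ↦ ∑ i, θ (extendVF (onb I x i)) x • onb I x i
  have hX : ∀ (Z : SmoothVF I M) x, inner ℝ (X x) (Z x) = θ Z x := by
    intro Z x
    have h : Z x = (∑ i, algebraMap ℝ (SmoothFn I M) (inner ℝ (onb I x i) (Z x)) •
        extendVF (onb I x i) : SmoothVF I M) x := by
      rw [SmoothVF.sum_apply]
      simp only [SmoothVF.smul_apply, extendVF_apply]
      exact ((onb I x).sum_repr' (Z x)).symm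
    rw [linearMap_congr θ h]
    simp only [X, sum_inner, real_inner_smul_left, map_sum, map_smul, SmoothFn.sum_apply]
    exact Finset.sum_congr rfl fun i _ ↦ mul_comm _ _
  have hs : IsSmoothField I X := by
    intro x
    obtain ⟨e, he⟩ := exists_orthonormal_frame (I := I) x
    refine (∑ i, θ (e i) • e i : SmoothVF I M).contMDiff.contMDiffAt.congr_of_eventuallyEq ?_
    filter_upwards [he] with y hy
    congr 1
    rw [SmoothVF.sum_apply, ← (onbOfOrthonormal hy).sum_repr' (X y)]
    refine Finset.sum_congr rfl fun i _ ↦ ?_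
    rw [onbOfOrthonormal_apply, real_inner_comm, hX]
    rfl
  exact ⟨⟨X, hs⟩, fun Z ↦ by ext x; exact hX Z x, fun x ↦ rfl⟩

end Frames

section LeviCivita

open Topology

variable {E : Type*} [NormedAddCommGroup E] [NormedSpace ℝ E] [FiniteDimensional ℝ E]
  {H : Type*} [TopologicalSpace H] {I : ModelWithCorners ℝ E H}
  {M : Type*} [TopologicalSpace M] [ChartedSpace H M] [IsManifold I ∞ M]
  [RiemannianBundle (fun x : M ↦ TangentSpace I x)]

/-! ### Locality -/

lemma dirDeriv_congr {X X' : Π x : M, TangentSpace I x} {f f' : M → ℝ} {x : M}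
    (hX : X x = X' x) (hf : f =ᶠ[𝓝 x] f') : dirDeriv I X f x = dirDeriv I X' f' x := by
  rw [dirDeriv, dirDeriv, hX]
  exact congrArg (fun L ↦ L (X' x)) (hf.mfderiv_eq (I := I) (I' := 𝓘(ℝ, ℝ)))

lemma koszul_congr {X X' Y Y' Z Z' : Π x : M, TangentSpace I x} {x : M}
    (hX : X =ᶠ[𝓝 x] X') (hY : Y =ᶠ[𝓝 x] Y') (hZ : Z =ᶠ[𝓝 x] Z') :
    koszul I X Y Z x = koszul I X' Y' Z' x := by
  have hm : ∀ {U U' V V' : Π x : M, TangentSpace I x}, U =ᶠ[𝓝 x] U' → V =ᶠ[𝓝 x] V' →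
      metric I U V =ᶠ[𝓝 x] metric I U' V' := by
    intro U U' V V' hU hV
    filter_upwards [hU, hV] with y h₁ h₂
    rw [metric, metric, h₁, h₂]
  have hb : ∀ {U U' V V' W W' : Π x : M, TangentSpace I x}, U =ᶠ[𝓝 x] U' → V =ᶠ[𝓝 x] V' →
      W =ᶠ[𝓝 x] W' → metric I U (mlieBracket I V W) x = metric I U' (mlieBracket I V' W') x := by
    intro U U' V V' W W' hU hV hW
    rw [metric, metric, hU.self_of_nhds, hV.mlieBracket_vectorField_eq hW]
  rw [koszul, koszul, dirDeriv_congr hX.self_of_nhds (hm hY hZ),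
    dirDeriv_congr hY.self_of_nhds (hm hZ hX), dirDeriv_congr hZ.self_of_nhds (hm hX hY),
    hb hX hY hZ, hb hY hZ hX, hb hZ hX hY]

lemma nabla_congr {X X' Y Y' : Π x : M, TangentSpace I x} {x : M}
    (hX : X =ᶠ[𝓝 x] X') (hY : Y =ᶠ[𝓝 x] Y') : nabla I X Y x = nabla I X' Y' x := by
  simp only [nabla]
  exact Finset.sum_congr rfl fun i _ ↦ congrArg (fun c : ℝ ↦ (c / 2) • onb I x i)
    (koszul_congr (Z := onbField I x i) (Z' := onbField I x i) hX hY .rfl)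

lemma nabla_eventuallyEq {X X' Y Y' : Π x : M, TangentSpace I x} {x : M}
    (hX : X =ᶠ[𝓝 x] X') (hY : Y =ᶠ[𝓝 x] Y') : nabla I X Y =ᶠ[𝓝 x] nabla I X' Y' := by
  filter_upwards [hX.eventuallyEq_nhds, hY.eventuallyEq_nhds] with y h₁ h₂
  exact nabla_congr h₁ h₂

lemma curvature_congr {X X' Y Y' Z Z' : Π x : M, TangentSpace I x} {x : M}
    (hX : X =ᶠ[𝓝 x] X') (hY : Y =ᶠ[𝓝 x] Y') (hZ : Z =ᶠ[𝓝 x] Z') :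
    curvature I X Y Z x = curvature I X' Y' Z' x := by
  rw [curvature, curvature, nabla_congr hX (nabla_eventuallyEq hY hZ),
    nabla_congr hY (nabla_eventuallyEq hX hZ), nabla_congr (hX.mlieBracket_vectorField hY) hZ]

/-! ### The Levi-Civita connection on smooth vector fields -/

variable [CompleteSpace E] [T2Space M]
  [IsContMDiffRiemannianBundle I ∞ E (fun x : M ↦ TangentSpace I x)]

namespace SmoothVF

lemma g_symm (X Y : SmoothVF I M) : g X Y = g Y X := by
  ext x; exact real_inner_comm (Y x) (X x)

lemma g_ext {X Y : SmoothVF I M} (h : ∀ Z, g X Z = g Y Z) : X = Y := by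
  ext x
  refine ext_inner_right ℝ fun v ↦ ?_
  have := congrArg (fun f : SmoothFn I M ↦ f x) (h (extendVF v))
  simpa [g_apply] using this

lemma eq_zero_of_smul_eq_zero [Nontrivial E] {f : SmoothFn I M}
    (h : ∀ Z : SmoothVF I M, f • Z = 0) : f = 0 := by
  ext x
  obtain ⟨v, hv⟩ : ∃ v : TangentSpace I x, v ≠ 0 := exists_ne (0 : E)
  have h' := congrArg (fun Z : SmoothVF I M ↦ Z x) (h (extendVF v))
  simp only [smul_apply, extendVF_apply] at h'
  exact (smul_eq_zero.1 h').resolve_right hv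

lemma deriv_lie [Nontrivial E] (X Y : SmoothVF I M) (f : SmoothFn I M) :
    deriv (lie X Y) f = deriv X (deriv Y f) - deriv Y (deriv X f) := by
  rw [← sub_eq_zero]
  refine eq_zero_of_smul_eq_zero fun Z ↦ ?_
  have h := jacobi X Y (f • Z)
  simp only [lie_smul, lie_add, jacobi X Y Z] at h
  linear_combination (norm := module) -h

lemma deriv_mul (X : SmoothVF I M) (f h : SmoothFn I M) :
    deriv X (f * h) = f * deriv X h + h * deriv X f := by
  simp [Derivation.leibniz]

/-- The right-hand side of the Koszul formula. -/
def kz (X Y : SmoothVF I M) : SmoothVF I M →ₗ[SmoothFn I M] SmoothFn I M where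
  toFun Z := deriv X (g Y Z) + deriv Y (g Z X) - deriv Z (g X Y) - g X (lie Y Z) + g Y (lie Z X)
    + g Z (lie X Y)
  map_add' Z Z' := by
    simp only [lie_swap _ X, lie_add, map_add, map_neg, LinearMap.add_apply, Derivation.add_apply]
    ring
  map_smul' f Z := by
    simp only [lie_swap _ X, lie_smul, map_add, map_smul, map_neg, LinearMap.smul_apply,
      Derivation.smul_apply, deriv_mul, smul_eq_mul, RingHom.id_apply, g_symm X Z, g_symm Y Z]
    ring

lemma kz_apply (X Y Z : SmoothVF I M) : kz X Y Z = deriv X (g Y Z) + deriv Y (g Z X)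
    - deriv Z (g X Y) - g X (lie Y Z) + g Y (lie Z X) + g Z (lie X Y) := rfl

lemma kz_apply_apply (X Y Z : SmoothVF I M) (x : M) : kz X Y Z x = koszul I X Y Z x := rfl

lemma exists_nab (X Y : SmoothVF I M) :
    ∃ N : SmoothVF I M, (∀ Z, g N Z = (2⁻¹ : ℝ) • kz X Y Z) ∧ ∀ x, N x = nabla I X Y x := by
  obtain ⟨N, hN, hN'⟩ := exists_sharp ((2⁻¹ : ℝ) • kz X Y)
  refine ⟨N, hN, fun x ↦ ?_⟩
  rw [hN', nabla]
  refine Finset.sum_congr rfl fun i _ ↦ ?_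
  congr 1
  change (2⁻¹ : ℝ) * kz X Y (extendVF (onb I x i)) x = _
  rw [kz_apply_apply, koszul_congr (X := X) (X' := X) (Y := Y) (Y' := Y) (Z' := onbField I x i)
    .rfl .rfl (extendVF_eventuallyEq (onb I x i)), div_eq_inv_mul]

/-- The covariant derivative of smooth vector fields. -/
def nab₀ (X Y : SmoothVF I M) : SmoothVF I M := (exists_nab X Y).choose

lemma g_nab₀ (X Y Z : SmoothVF I M) : 2 * g (nab₀ X Y) Z = kz X Y Z := by
  rw [nab₀, (exists_nab X Y).choose_spec.1,
    show (2 : SmoothFn I M) = algebraMap ℝ _ 2 from (map_ofNat _ 2).symm, ← Algebra.smul_def,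
    smul_smul]
  norm_num

lemma nab₀_apply (X Y : SmoothVF I M) (x : M) : nab₀ X Y x = nabla I X Y x :=
  (exists_nab X Y).choose_spec.2 x

lemma g_ext_two {X Y : SmoothVF I M} (h : ∀ Z, 2 * g X Z = 2 * g Y Z) : X = Y :=
  g_ext fun Z ↦ RiemannianCalculus.eq_of_two_mul (h Z)

/-- The Levi-Civita connection on smooth vector fields. -/
def nab : SmoothVF I M →ₗ[SmoothFn I M] SmoothVF I M →ₗ[ℝ] SmoothVF I M :=
  LinearMap.mk₂' (SmoothFn I M) ℝ nab₀
    (fun X X' Y ↦ g_ext_two fun Z ↦ by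
      simp only [map_add, LinearMap.add_apply, mul_add, g_nab₀, kz_apply, lie_swap _ Y, lie_add,
        map_neg, Derivation.add_apply]
      ring)
    (fun f X Y ↦ g_ext_two fun Z ↦ by
      simp only [map_smul, LinearMap.smul_apply, smul_eq_mul, mul_left_comm _ f, g_nab₀, kz_apply]
      simp only [lie_swap _ Y, lie_smul, map_smul, map_add,
        map_neg, Derivation.smul_apply, deriv_mul, smul_eq_mul, g_symm Y X, g_symm Z X]
      ring)
    (fun X Y Y' ↦ g_ext_two fun Z ↦ by
      simp only [map_add, LinearMap.add_apply, mul_add, g_nab₀, kz_apply, lie_swap _ Z, lie_add,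
        map_neg, Derivation.add_apply]
      ring)
    (fun r X Y ↦ g_ext_two fun Z ↦ by
      rw [← algebraMap_smul (SmoothFn I M) r Y, ← algebraMap_smul (SmoothFn I M) r (nab₀ X Y)]
      simp only [map_smul, LinearMap.smul_apply, smul_eq_mul, mul_left_comm _ (algebraMap _ _ r),
        g_nab₀, kz_apply]
      simp only [lie_swap _ Z, lie_smul, map_smul, map_add, map_neg, Derivation.smul_apply,
        deriv_mul, smul_eq_mul, Derivation.map_algebraMap]
      ring)

lemma nab_apply (X Y : SmoothVF I M) (x : M) : nab X Y x = nabla I X Y x := nab₀_apply X Y x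

lemma g_nab (X Y Z : SmoothVF I M) : 2 * g (nab X Y) Z = kz X Y Z := g_nab₀ X Y Z

lemma nab_smul (X : SmoothVF I M) (f : SmoothFn I M) (Y : SmoothVF I M) :
    nab X (f • Y) = deriv X f • Y + f • nab X Y :=
  g_ext_two fun Z ↦ by
    have h := g_nab X Y Z
    simp only [kz_apply] at h
    simp only [g_nab, kz_apply]
    simp only [lie_swap _ Z, lie_smul, map_smul, map_add, map_neg, Derivation.smul_apply,
      LinearMap.smul_apply, LinearMap.add_apply, deriv_mul, smul_eq_mul, g_symm X Y,
      g_symm Z X, g_symm Z Y] at h ⊢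
    linear_combination -f * h

lemma deriv_g (X Y Z : SmoothVF I M) : deriv X (g Y Z) = g (nab X Y) Z + g Y (nab X Z) := by
  apply RiemannianCalculus.eq_of_two_mul
  rw [mul_add, g_symm Y (nab X Z), g_nab, g_nab, kz_apply, kz_apply, lie_swap Z Y, lie_swap Z X,
    lie_swap Y X, g_symm Z Y, g_symm X Z, g_symm Y X]
  simp only [map_neg]
  ring

lemma nab_sub_nab (X Y : SmoothVF I M) : nab X Y - nab Y X = lie X Y :=
  g_ext_two fun Z ↦ by
    rw [map_sub, LinearMap.sub_apply, mul_sub, g_nab, g_nab, kz_apply, kz_apply, lie_swap Z Y,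
      lie_swap Z X, lie_swap Y X, g_symm Z Y, g_symm X Z, g_symm Y X, g_symm (lie X Y) Z]
    simp only [map_neg]
    ring

end SmoothVF

end LeviCivita

section Trace

open Topology

variable {E : Type*} [NormedAddCommGroup E] [NormedSpace ℝ E] [FiniteDimensional ℝ E]
  {H : Type*} [TopologicalSpace H] {I : ModelWithCorners ℝ E H}
  {M : Type*} [TopologicalSpace M] [T2Space M] [ChartedSpace H M] [IsManifold I ∞ M]
  [RiemannianBundle (fun x : M ↦ TangentSpace I x)]
  [IsContMDiffRiemannianBundle I ∞ E (fun x : M ↦ TangentSpace I x)]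

namespace SmoothVF

/-- The value at `x` of an endomorphism of the module of smooth vector fields. -/
def endoAt (x : M) (A : SmoothVF I M →ₗ[SmoothFn I M] SmoothVF I M) :
    TangentSpace I x →ₗ[ℝ] TangentSpace I x where
  toFun v := A (extendVF v) x
  map_add' v w := by
    rw [endo_congr A (Z := extendVF v + extendVF w) (by simp), map_add]; rfl
  map_smul' r v := by
    rw [endo_congr A (Z := algebraMap ℝ (SmoothFn I M) r • extendVF v)
      (by rw [smul_apply, extendVF_apply, extendVF_apply]; rfl), map_smul]
    rfl

lemma endoAt_apply (A : SmoothVF I M →ₗ[SmoothFn I M] SmoothVF I M) (x : M) (Z : SmoothVF I M) :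
    endoAt x A (Z x) = A Z x :=
  endo_congr A (by simp)

lemma endoAt_apply' (A : SmoothVF I M →ₗ[SmoothFn I M] SmoothVF I M) (x : M)
    (v : TangentSpace I x) : endoAt x A v = A (extendVF v) x := rfl

lemma trace_endoAt (A : SmoothVF I M →ₗ[SmoothFn I M] SmoothVF I M) {ι : Type*} [Fintype ι]
    {x : M} (b : OrthonormalBasis ι ℝ (TangentSpace I x)) :
    LinearMap.trace ℝ _ (endoAt x A) = ∑ i, inner ℝ (A (extendVF (b i)) x) (b i) := by
  rw [LinearMap.trace_eq_sum_inner _ b]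
  exact Finset.sum_congr rfl fun i _ ↦ real_inner_comm _ _

lemma trace_endoAt_frame (A : SmoothVF I M →ₗ[SmoothFn I M] SmoothVF I M)
    {e : Fin (Module.finrank ℝ E) → SmoothVF I M} {x : M} (h : Orthonormal ℝ (fun i ↦ e i x)) :
    LinearMap.trace ℝ _ (endoAt x A) = (∑ i, g (A (e i)) (e i)) x := by
  rw [trace_endoAt A (onbOfOrthonormal h), SmoothFn.sum_apply]
  refine Finset.sum_congr rfl fun i _ ↦ ?_
  rw [onbOfOrthonormal_apply, g_apply, ← endoAt_apply', endoAt_apply]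

/-- The trace of an endomorphism of the module of smooth vector fields. -/
def tr : (SmoothVF I M →ₗ[SmoothFn I M] SmoothVF I M) →ₗ[SmoothFn I M] SmoothFn I M where
  toFun A := ⟨fun x ↦ LinearMap.trace ℝ _ (endoAt x A), fun x ↦ by
    obtain ⟨e, he⟩ := exists_orthonormal_frame (I := I) x
    refine (∑ i, g (A (e i)) (e i) : SmoothFn I M).contMDiff.contMDiffAt.congr_of_eventuallyEq ?_
    filter_upwards [he] with y hy
    exact trace_endoAt_frame A hy⟩
  map_add' A B := by
    ext x
    exact map_add (LinearMap.trace ℝ (TangentSpace I x)) (endoAt x A) (endoAt x B)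
  map_smul' f A := by
    ext x
    exact map_smul (LinearMap.trace ℝ (TangentSpace I x)) (f x) (endoAt x A)

lemma tr_apply (A : SmoothVF I M →ₗ[SmoothFn I M] SmoothVF I M) (x : M) :
    tr A x = LinearMap.trace ℝ _ (endoAt x A) := rfl

lemma tr_eventuallyEq (A : SmoothVF I M →ₗ[SmoothFn I M] SmoothVF I M)
    {e : Fin (Module.finrank ℝ E) → SmoothVF I M} {x : M}
    (he : ∀ᶠ y in 𝓝 x, Orthonormal ℝ (fun i ↦ e i y)) :
    (tr A : M → ℝ) =ᶠ[𝓝 x] (∑ i, g (A (e i)) (e i) : SmoothFn I M) := by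
  filter_upwards [he] with y hy
  exact trace_endoAt_frame A hy

lemma tr_comp_comm (A B : SmoothVF I M →ₗ[SmoothFn I M] SmoothVF I M) :
    tr (A ∘ₗ B) = tr (B ∘ₗ A) := by
  have h : ∀ (A B : SmoothVF I M →ₗ[SmoothFn I M] SmoothVF I M) (x : M),
      endoAt x (A ∘ₗ B) = endoAt x A ∘ₗ endoAt x B := fun A B x ↦ by
    ext v
    rw [LinearMap.comp_apply, endoAt_apply' B, endoAt_apply]
    rfl
  ext x
  rw [tr_apply, tr_apply, h, h]
  exact LinearMap.trace_comp_comm' _ _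

lemma tr_smulRight (θ : SmoothVF I M →ₗ[SmoothFn I M] SmoothFn I M) (X : SmoothVF I M) :
    tr (θ.smulRight X) = θ X := by
  ext x
  obtain ⟨e, he⟩ := exists_orthonormal_frame (I := I) x
  rw [(tr_eventuallyEq _ he).self_of_nhds, linearMap_apply_eq_sum θ he, SmoothFn.sum_apply]
  refine Finset.sum_congr rfl fun i _ ↦ ?_
  rw [LinearMap.smulRight_apply, map_smul, LinearMap.smul_apply, smul_eq_mul, mul_comm,
    g_symm]
  rfl

lemma tr_adjoint {A B : SmoothVF I M →ₗ[SmoothFn I M] SmoothVF I M}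
    (h : ∀ X Y, g (A X) Y = g X (B Y)) : tr A = tr B := by
  ext x
  obtain ⟨e, he⟩ := exists_orthonormal_frame (I := I) x
  rw [(tr_eventuallyEq _ he).self_of_nhds, (tr_eventuallyEq _ he).self_of_nhds]
  simp only [h, g_symm (e _)]

lemma tr_id : tr (LinearMap.id : SmoothVF I M →ₗ[SmoothFn I M] SmoothVF I M)
    = (Module.finrank ℝ E : SmoothFn I M) := by
  ext x
  have h : endoAt x (LinearMap.id : SmoothVF I M →ₗ[SmoothFn I M] SmoothVF I M)
      = LinearMap.id := by
    ext v; exact extendVF_apply v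
  rw [tr_apply, h, LinearMap.trace_id, ← map_natCast (algebraMap ℝ (SmoothFn I M))]
  rfl

variable [CompleteSpace E]

lemma deriv_congr (X : SmoothVF I M) {f h : SmoothFn I M} {x : M}
    (hf : (f : M → ℝ) =ᶠ[𝓝 x] h) : deriv X f x = deriv X h x :=
  dirDeriv_congr rfl hf

lemma g_nab_skew (X : SmoothVF I M) {e : Fin (Module.finrank ℝ E) → SmoothVF I M} {x : M}
    (he : ∀ᶠ y in 𝓝 x, Orthonormal ℝ (fun i ↦ e i y)) (i j : Fin (Module.finrank ℝ E)) :
    g (e j) (nab X (e i)) x = -g (e i) (nab X (e j)) x := by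
  have h := deriv_congr X (f := g (e i) (e j))
    (h := algebraMap ℝ (SmoothFn I M) (if i = j then 1 else 0)) (x := x) (by
      filter_upwards [he] with y hy
      exact orthonormal_iff_ite.1 hy i j)
  rw [Derivation.map_algebraMap, deriv_g, g_symm (nab X (e i))] at h
  exact eq_neg_of_add_eq_zero_left h

lemma deriv_tr (X : SmoothVF I M) {A B : SmoothVF I M →ₗ[SmoothFn I M] SmoothVF I M}
    (h : ∀ Z, B Z = nab X (A Z) - A (nab X Z)) : deriv X (tr A) = tr B := by
  ext x
  obtain ⟨e, he⟩ := exists_orthonormal_frame (I := I) x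
  rw [deriv_congr X (tr_eventuallyEq A he), (tr_eventuallyEq B he).self_of_nhds]
  have h₁ : deriv X (∑ i, g (A (e i)) (e i)) = ∑ i, g (B (e i)) (e i)
      + ∑ i, (g (A (nab X (e i))) (e i) + g (A (e i)) (nab X (e i))) := by
    rw [map_sum, ← Finset.sum_add_distrib]
    refine Finset.sum_congr rfl fun i _ ↦ ?_
    rw [deriv_g, h, map_sub, LinearMap.sub_apply]
    ring
  rw [h₁]
  change _ + (∑ i, (g (A (nab X (e i))) (e i) + g (A (e i)) (nab X (e i))) : SmoothFn I M) x = _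
  rw [add_eq_left, SmoothFn.sum_apply]
  have h₂ : ∀ i, (g (A (nab X (e i))) (e i) + g (A (e i)) (nab X (e i))) x
      = ∑ j, g (e j) (nab X (e i)) x * g (A (e j)) (e i) x
        + ∑ j, g (e j) (nab X (e i)) x * g (A (e i)) (e j) x := fun i ↦ by
    exact congrArg₂ (· + ·)
      (linearMap_apply_eq_sum ((g.flip (e i)).comp A) he (nab X (e i)))
      (linearMap_apply_eq_sum (g (A (e i))) he (nab X (e i)))
  simp only [h₂, Finset.sum_add_distrib]
  rw [Finset.sum_comm, ← Finset.sum_add_distrib]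
  refine Finset.sum_eq_zero fun i _ ↦ ?_
  rw [← Finset.sum_add_distrib]
  refine Finset.sum_eq_zero fun j _ ↦ ?_
  rw [g_nab_skew X he i j]
  ring

variable (I M) in
/-- The calculus of smooth vector fields on a Riemannian manifold. -/
def calculus [Nontrivial E] : RiemannianCalculus (SmoothFn I M) (SmoothVF I M) where
  D := deriv
  g := g
  nab := nab
  lie := lie
  tr := tr
  dim := Module.finrank ℝ E
  g_symm := g_symm
  g_ext := g_ext
  exists_sharp θ := (exists_sharp θ).imp fun _ h ↦ h.1
  nab_smul := nab_smul
  D_g := deriv_g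
  nab_sub_nab := nab_sub_nab
  D_lie := deriv_lie
  jacobi := jacobi
  tr_comp_comm := tr_comp_comm
  tr_smulRight := tr_smulRight
  tr_adjoint := tr_adjoint
  D_tr := deriv_tr
  tr_id := tr_id

end SmoothVF

end Trace

namespace RiemannianCalculus.Kenmotsu

variable {F 𝔛 : Type*} [CommRing F] [Algebra ℝ F] [AddCommGroup 𝔛]
    [Module ℝ 𝔛] [Module F 𝔛] [IsScalarTower ℝ F 𝔛] {C : RiemannianCalculus F 𝔛}

lemma ric_eq (K : C.Kenmotsu) (Y Z : 𝔛) :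
    K.ric Y Z = C.isTorsionFree_nab.ric Y Z + ((C.dim : F) - 1) * C.g Y Z := by
  have h : K.isTorsionFree_tn.curvLeft Y Z = C.isTorsionFree_nab.curvLeft Y Z
      + C.g Y Z • LinearMap.id - (C.g Z).smulRight Y := by
    ext X
    change C.curv K.tn X Y Z = C.curv C.nab X Y Z + C.g Y Z • X - C.g Z X • Y
    rw [K.curv_tn, C.g_symm Z X]
  rw [ric, IsTorsionFree.ric_apply, h, map_sub, map_add, map_smul, C.tr_smulRight, C.tr_id,
    IsTorsionFree.ric_apply, C.g_symm Z Y, smul_eq_mul]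
  ring

end RiemannianCalculus.Kenmotsu

section Link

open Topology

variable {E : Type*} [NormedAddCommGroup E] [NormedSpace ℝ E] [FiniteDimensional ℝ E]
  {H : Type*} [TopologicalSpace H] {I : ModelWithCorners ℝ E H}
  {M : Type*} [TopologicalSpace M] [T2Space M] [ChartedSpace H M] [IsManifold I ∞ M]
  [RiemannianBundle (fun x : M ↦ TangentSpace I x)]
  [IsContMDiffRiemannianBundle I ∞ E (fun x : M ↦ TangentSpace I x)]
  [CompleteSpace E] [Nontrivial E]

open SmoothVF

lemma curvature_eq_curv (X Y Z : SmoothVF I M) (x : M) :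
    curvature I X Y Z x = (calculus I M).curv (calculus I M).nab X Y Z x := by
  have h : ∀ X Y : SmoothVF I M, nabla I X Y = nab X Y := fun X Y ↦
    funext fun x ↦ (nab_apply X Y x).symm
  rw [curvature, h Y Z, h X Z, h X (nab Y Z), h Y (nab X Z)]
  exact congrArg (fun v : TangentSpace I x ↦ nab X (nab Y Z) x - nab Y (nab X Z) x - v)
    (nab_apply (lie X Y) Z x).symm

lemma ricci_eq_ric (Y Z : SmoothVF I M) (x : M) :
    ricci I Y Z x = (calculus I M).isTorsionFree_nab.ric Y Z x := by
  change _ = tr ((calculus I M).isTorsionFree_nab.curvLeft Y Z) x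
  rw [tr_apply, trace_endoAt _ (onb I x), ricci]
  refine Finset.sum_congr rfl fun i _ ↦ ?_
  rw [← curvature_congr (Y := Y) (Y' := Y) (Z := Z) (Z' := Z) (extendVF_eventuallyEq (onb I x i))
    .rfl .rfl, curvature_eq_curv]
  rfl

lemma ricci_congr {Y Y' Z Z' : Π x : M, TangentSpace I x} {x : M}
    (hY : Y =ᶠ[𝓝 x] Y') (hZ : Z =ᶠ[𝓝 x] Z') : ricci I Y Z x = ricci I Y' Z' x := by
  simp only [ricci]
  exact Finset.sum_congr rfl fun i _ ↦ congrArg (fun v ↦ (inner ℝ v (onb I x i) : ℝ))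
    (curvature_congr (X := onbField I x i) (X' := onbField I x i) .rfl hY hZ)

lemma scalarCurvature_eq_sum (x : M) : scalarCurvature I x =
    ∑ i, (calculus I M).isTorsionFree_nab.ric (extendVF (onb I x i)) (extendVF (onb I x i)) x := by
  rw [scalarCurvature]
  refine Finset.sum_congr rfl fun i _ ↦ ?_
  rw [← ricci_eq_ric]
  exact (ricci_congr (extendVF_eventuallyEq (onb I x i)) (extendVF_eventuallyEq (onb I x i))).symm

lemma scalarCurvature_eq_zero (h : Module.finrank ℝ E = 1) (x : M) : scalarCurvature I x = 0 := by
  have hs : Subsingleton (Fin (Module.finrank ℝ (TangentSpace I x))) := by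
    change Subsingleton (Fin (Module.finrank ℝ E))
    rw [h]; infer_instance
  rw [scalarCurvature_eq_sum]
  refine Finset.sum_eq_zero fun i _ ↦ ?_
  rw [← ricci_eq_ric, ricci]
  refine Finset.sum_eq_zero fun j _ ↦ ?_
  rw [Subsingleton.elim j i, ← curvature_congr (Y := extendVF (onb I x i))
    (Y' := extendVF (onb I x i)) (Z := extendVF (onb I x i)) (Z' := extendVF (onb I x i))
    (extendVF_eventuallyEq (onb I x i)) .rfl .rfl, curvature_eq_curv]
  have h' := congrArg (fun Z : SmoothVF I M ↦ (inner ℝ (Z x) (onb I x i) : ℝ))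
    (RiemannianCalculus.curv_swap (C := calculus I M) (c := (calculus I M).nab)
      (extendVF (onb I x i)) (extendVF (onb I x i)) (extendVF (onb I x i)))
  exact self_eq_neg.1 (h'.trans (inner_neg_left _ _))

lemma scalarCurvature_eq (K : (calculus I M).Kenmotsu) (x : M) :
    scalarCurvature I x = tr K.ricOp x
      - ((Module.finrank ℝ E : ℝ) - 1) * (Module.finrank ℝ E : ℝ) := by
  rw [scalarCurvature_eq_sum, tr_apply, trace_endoAt _ (onb I x)]
  have h : ∀ i, (calculus I M).isTorsionFree_nab.ric (extendVF (onb I x i))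
      (extendVF (onb I x i)) x = inner ℝ (K.ricOp (extendVF (onb I x i)) x) (onb I x i)
        - ((Module.finrank ℝ E : ℝ) - 1) := fun i ↦ by
    have h₁ := congrArg (fun f : SmoothFn I M ↦ f x)
      (K.ric_eq (extendVF (onb I x i)) (extendVF (onb I x i)))
    rw [← K.g_ricOp] at h₁
    have h₂ : (inner ℝ (K.ricOp (extendVF (onb I x i)) x) (extendVF (onb I x i) x) : ℝ)
        = (calculus I M).isTorsionFree_nab.ric (extendVF (onb I x i)) (extendVF (onb I x i)) x
          + (((Module.finrank ℝ E : ℕ) : SmoothFn I M) x - 1)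
            * inner ℝ (extendVF (onb I x i) x) (extendVF (onb I x i) x) := h₁
    rw [extendVF_apply, real_inner_self_eq_norm_sq, OrthonormalBasis.norm_eq_one,
      ← map_natCast (algebraMap ℝ (SmoothFn I M))] at h₂
    change _ = _ + ((Module.finrank ℝ E : ℝ) - 1) * 1 ^ 2 at h₂
    linear_combination -h₂
  simp only [h, Finset.sum_sub_distrib, Finset.sum_const, Finset.card_univ, Fintype.card_fin,
    nsmul_eq_mul, show Module.finrank ℝ (TangentSpace I x) = Module.finrank ℝ E from rfl]
  ring

namespace AlmostContactMetric

variable (A : AlmostContactMetric I M)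

/-- The action of the `(1,1)`-tensor field on smooth vector fields. -/
def φVF : SmoothVF I M →ₗ[SmoothFn I M] SmoothVF I M where
  toFun X := ⟨fun x ↦ A.φ x (X x), ContMDiff.clm_bundle_apply (b := fun x : M ↦ x)
    (E₁ := (TangentSpace I : M → Type _)) (E₂ := (TangentSpace I : M → Type _)) (F₁ := E)
    (F₂ := E) A.φ_smooth X.contMDiff⟩
  map_add' X Y := by ext x; exact map_add (A.φ x) (X x) (Y x)
  map_smul' f X := by ext x; exact map_smul (A.φ x) (f x) (X x)

lemma φ_apply_ξ (x : M) : A.φ x (A.ξ x) = 0 := by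
  have h := A.inner_φ x (A.ξ x) (A.ξ x)
  rw [← A.η_eq, A.η_ξ, mul_one, sub_self] at h
  exact inner_self_eq_zero.1 h

variable {A}

/-- The algebraic form of a Kenmotsu structure. -/
def IsKenmotsu.kenmotsu (hA : A.IsKenmotsu) : (calculus I M).Kenmotsu where
  φ := A.φVF
  ξ := A.ξ_smooth.toVF
  φ_φ' X := by
    ext x
    have := A.φ_sq x (X x)
    rw [A.η_eq] at this
    exact this
  g_ξ_ξ := by
    ext x
    exact (A.η_eq x (A.ξ x)).symm.trans (A.η_ξ x)
  φ_ξ := by ext x; exact A.φ_apply_ξ x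
  g_φ_φ' X Y := by
    ext x
    have := A.inner_φ x (X x) (Y x)
    rw [A.η_eq, A.η_eq] at this
    exact this
  nab_φ' X Y := by
    ext x
    have := hA X Y X.isSmoothField Y.isSmoothField x
    rw [A.η_eq, ← nab_apply X Y] at this
    have h' := nab_apply X (A.φVF Y) x
    change nab X (A.φVF Y) x - A.φ x (nab X Y x) = _
    rw [h']
    exact this

lemma IsConformalEtaRicciSoliton.isSoliton {V : Π x : M, TangentSpace I x} {lam mu p : ℝ}
    (hA : A.IsKenmotsu) (hV : A.IsConformalEtaRicciSoliton V lam mu p) :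
    hA.kenmotsu.IsSoliton hV.1.toVF
      (algebraMap ℝ (SmoothFn I M) ((Module.finrank ℝ E : ℝ) - 1
        - (2 * lam - (p + 2 / (Module.finrank ℝ E : ℝ))) / 2 - mu))
      (algebraMap ℝ (SmoothFn I M) mu) where
  D_a X := Derivation.map_algebraMap _ _
  D_m X := Derivation.map_algebraMap _ _
  eq X Y := by
    rw [hA.kenmotsu.ric_eq, ← map_ofNat (algebraMap ℝ (SmoothFn I M)) 2]
    ext x
    have h := hV.2 X Y X.isSmoothField Y.isSmoothField x
    rw [A.η_eq, A.η_eq, ricci_eq_ric] at h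
    have hd : (((calculus I M).dim : ℕ) : SmoothFn I M) x = (Module.finrank ℝ E : ℝ) := by
      rw [← map_natCast (algebraMap ℝ (SmoothFn I M))]; rfl
    change lieDerivMetric I V X Y x = -(2 : ℝ) * ((calculus I M).isTorsionFree_nab.ric X Y x
      + ((((calculus I M).dim : ℕ) : SmoothFn I M) x - 1) * metric I X Y x)
      + 2 * (((Module.finrank ℝ E : ℝ) - 1
        - (2 * lam - (p + 2 / (Module.finrank ℝ E : ℝ))) / 2 - mu) + mu) * metric I X Y x
      - 2 * mu * (inner ℝ (X x) (A.ξ x) * inner ℝ (Y x) (A.ξ x))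
    rw [hd]
    linear_combination h

end AlmostContactMetric

end Link

end RiemannianGeometry

end

theorem xi_scalar_curvature_eq_of_conformal_eta_ricci_soliton
    (n : ℕ) {M : Type*} [TopologicalSpace M] [T2Space M] [SecondCountableTopology M]
    [ChartedSpace (EuclideanSpace ℝ (Fin (2 * n + 1))) M] [IsManifold (𝓡 (2 * n + 1)) ∞ M]
    [RiemannianBundle (fun x : M ↦ TangentSpace (𝓡 (2 * n + 1)) x)]
    [IsContMDiffRiemannianBundle (𝓡 (2 * n + 1)) ∞ (EuclideanSpace ℝ (Fin (2 * n + 1)))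
      (fun x : M ↦ TangentSpace (𝓡 (2 * n + 1)) x)]
    (A : RiemannianGeometry.AlmostContactMetric (𝓡 (2 * n + 1)) M) (hA : A.IsKenmotsu)
    (V : Π x : M, TangentSpace (𝓡 (2 * n + 1)) x) (lam mu p : ℝ)
    (hV : A.IsConformalEtaRicciSoliton V lam mu p) :
    MDifferentiable (𝓡 (2 * n + 1)) 𝓘(ℝ, ℝ)
        (RiemannianGeometry.scalarCurvature (𝓡 (2 * n + 1)) : M → ℝ) ∧
      ∀ x : M,
        RiemannianGeometry.dirDeriv (𝓡 (2 * n + 1)) A.ξ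
            (RiemannianGeometry.scalarCurvature (𝓡 (2 * n + 1))) x
          = -2 * (n : ℝ) * (RiemannianGeometry.scalarCurvature (𝓡 (2 * n + 1)) x
              + 2 * (n : ℝ) * (2 * (n : ℝ) + 1)) := by
  have hd : Module.finrank ℝ (EuclideanSpace ℝ (Fin (2 * n + 1))) = 2 * n + 1 :=
    finrank_euclideanSpace_fin
  have hd' : (Module.finrank ℝ (EuclideanSpace ℝ (Fin (2 * n + 1))) : ℝ) = 2 * n + 1 := by
    rw [hd]; push_cast; rfl
  let e := RiemannianGeometry.SmoothVF.tr hA.kenmotsu.ricOp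
  let f : RiemannianGeometry.SmoothFn (𝓡 (2 * n + 1)) M :=
    e - algebraMap ℝ _ (2 * (n : ℝ) * (2 * (n : ℝ) + 1))
  have hf : (RiemannianGeometry.scalarCurvature (𝓡 (2 * n + 1)) : M → ℝ) = f := funext fun x ↦ by
    rw [RiemannianGeometry.scalarCurvature_eq hA.kenmotsu x, hd', add_sub_cancel_right]
    rfl
  have hr : ∀ x : M, RiemannianGeometry.scalarCurvature (𝓡 (2 * n + 1)) x
      + 2 * (n : ℝ) * (2 * (n : ℝ) + 1) = e x := fun x ↦ by
    rw [hf]; exact sub_add_cancel _ _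
  refine ⟨hf ▸ f.contMDiff.mdifferentiable (by simp), fun x ↦ ?_⟩
  have hξ : RiemannianGeometry.dirDeriv (𝓡 (2 * n + 1)) A.ξ
      (RiemannianGeometry.scalarCurvature (𝓡 (2 * n + 1))) x = -2 * e x := by
    have h : RiemannianGeometry.SmoothVF.deriv A.ξ_smooth.toVF f = -2 * e := by
      rw [map_sub, Derivation.map_algebraMap, sub_zero]
      exact hA.kenmotsu.D_ξ_tr_ricOp
    rw [← map_ofNat (algebraMap ℝ (RiemannianGeometry.SmoothFn (𝓡 (2 * n + 1)) M)) 2] at h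
    rw [hf]
    exact congrArg (fun k : RiemannianGeometry.SmoothFn (𝓡 (2 * n + 1)) M ↦ k x) h
  rw [hξ, hr]
  by_cases h₀ : n = 0
  · have hn : (n : ℝ) = 0 := by exact_mod_cast h₀
    have h := hr x
    rw [RiemannianGeometry.scalarCurvature_eq_zero (by rw [hd, h₀]) x, hn] at h
    rw [← h, hn]; ring
  by_cases h₁ : n = 1
  · have hn : (n : ℝ) = 1 := by exact_mod_cast h₁
    rw [hn, mul_one]
  have h : e = 0 := (hV.isSoliton hA).tr_ricOp_eq_zero hd h₀ h₁
  rw [h]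
  exact (mul_zero (-2 : ℝ)).trans (mul_zero _).symm
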